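/- arXiv:1512.02927 — 4 statements merged into one kernel-verified Lean document; each statement's English description precedes it below -/
import Mathlib

section
/- Let K ⊂ ℝⁿ be a convex body containing 0 in its interior, and suppose ∂K has positive generalized Gauss curvature at a point X₀ ∈ ∂K whose (unique) outer normal vector at X₀ is not parallel to the vector X₀. Then there exist u ∈ S^{n−1} and α > 0 such that the cap K(α, u) = {X ∈ K : ⟨X, u⟩ ≥ α} has nonempty interior and max_{X ∈ K(α,u)} |X| < |X₀|. -/
open MeasureTheory Metric Set Filter
open scoped InnerProductSpace Topology

noncomputable section

/-- A convex body in ℝⁿ: a compact convex set with nonempty interior. -/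
def IsConvexBody {n : ℕ} (K : Set (EuclideanSpace ℝ (Fin n))) : Prop :=
  IsCompact K ∧ Convex ℝ K ∧ (interior K).Nonempty

/-- The centroid of a set. -/
def centroid {n : ℕ} (K : Set (EuclideanSpace ℝ (Fin n))) : EuclideanSpace ℝ (Fin n) :=
  ((volume K).toReal)⁻¹ • ∫ x in K, x

/-- `(1/n!) ∫_{A}⋯∫_{A} det(X₁ − g, …, Xₙ − g)² dX₁ ⋯ dXₙ`. -/
def detInt {n : ℕ} (A : Set (EuclideanSpace ℝ (Fin n))) (g : EuclideanSpace ℝ (Fin n)) : ℝ :=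
  ((n.factorial : ℝ))⁻¹ *
    ∫ X in Set.univ.pi (fun _ : Fin n => A),
      (Matrix.det (Matrix.of fun i j : Fin n => X j i - g i)) ^ 2
      ∂(Measure.pi fun _ : Fin n => volume)

/-- `M_K^{2n}`, the 2n-th power of the isotropy parameter of a convex body. -/
def Mpow2n {n : ℕ} (K : Set (EuclideanSpace ℝ (Fin n))) : ℝ := detInt K (centroid K)

/-- The isotropy constant `L_K = M_K / |K|^{(n+2)/(2n)}` of a convex body. -/
def isoL (n : ℕ) (K : Set (EuclideanSpace ℝ (Fin n))) : ℝ :=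
  (Mpow2n K) ^ ((2 * (n : ℝ)))⁻¹ / (volume K).toReal ^ (((n : ℝ) + 2) / (2 * n))

/-- `K` is isotropic with isotropy parameter `M`. -/
def IsIsotropic {n : ℕ} (K : Set (EuclideanSpace ℝ (Fin n))) (M : ℝ) : Prop :=
  0 < M ∧ (∫ x in K, x) = 0 ∧
    ∀ y : EuclideanSpace ℝ (Fin n), (∫ x in K, (⟪x, y⟫_ℝ) ^ 2) = M ^ 2 * ‖y‖ ^ 2

/-- `(N, q)` witnesses positive generalized Gauss curvature of `K` at `X₀`. -/
def CurvWitness {n : ℕ} (K : Set (EuclideanSpace ℝ (Fin n))) (X₀ N : EuclideanSpace ℝ (Fin n))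
    (q : QuadraticForm ℝ (EuclideanSpace ℝ (Fin n))) : Prop :=
  ‖N‖ = 1 ∧ (∀ x ∈ K, 0 ≤ ⟪x - X₀, N⟫_ℝ) ∧
  (∀ Y : EuclideanSpace ℝ (Fin n), ⟪Y, N⟫_ℝ = 0 → Y ≠ 0 → 0 < q Y) ∧
  ∀ ε > (0 : ℝ), ∃ a > (0 : ℝ), ∀ (Y : EuclideanSpace ℝ (Fin n)) (y : ℝ), ⟪Y, N⟫_ℝ = 0 →
    X₀ + Y + y • N ∈ frontier K ∩ Metric.ball X₀ a →
    (1 - ε) * q Y ≤ y ∧ y ≤ (1 + ε) * q Y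

/-- `K` has positive generalized Gauss curvature at `X₀`. -/
def HasPosGenCurvature {n : ℕ} (K : Set (EuclideanSpace ℝ (Fin n)))
    (X₀ : EuclideanSpace ℝ (Fin n)) : Prop :=
  ∃ N q, CurvWitness K X₀ N q

/-- `K` is a local maximizer for the isotropy constant (Hausdorff distance). -/
def IsLocalMaxIso {n : ℕ} (K : Set (EuclideanSpace ℝ (Fin n))) : Prop :=
  ∃ ε > (0 : ℝ), ∀ K' : Set (EuclideanSpace ℝ (Fin n)), IsConvexBody K' →
    hausdorffDist K' K < ε → isoL n K' ≤ isoL n K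

/-- `K` is a local minimizer for the isotropy constant (Hausdorff distance). -/
def IsLocalMinIso {n : ℕ} (K : Set (EuclideanSpace ℝ (Fin n))) : Prop :=
  ∃ ε > (0 : ℝ), ∀ K' : Set (EuclideanSpace ℝ (Fin n)), IsConvexBody K' →
    hausdorffDist K' K < ε → isoL n K ≤ isoL n K'

/-- `X₀` is a point of local strict convexity of `∂K`. -/
def IsLocalStrictConvexPoint {n : ℕ} (K : Set (EuclideanSpace ℝ (Fin n)))
    (X₀ : EuclideanSpace ℝ (Fin n)) : Prop :=
  X₀ ∈ frontier K ∧
    ¬ ∃ A B : EuclideanSpace ℝ (Fin n), A ≠ B ∧ segment ℝ A B ⊆ frontier K ∧ X₀ ∈ segment ℝ A B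


/-- A quadratic form which is positive on the nonzero vectors of `N^⊥` is bounded below there by a
positive multiple of the squared norm. -/
theorem exists_pos_mul_norm_sq_le {n : ℕ} (N : EuclideanSpace ℝ (Fin n))
    (q : QuadraticForm ℝ (EuclideanSpace ℝ (Fin n)))
    (hq : ∀ Y : EuclideanSpace ℝ (Fin n), ⟪Y, N⟫_ℝ = 0 → Y ≠ 0 → 0 < q Y) :
    ∃ μ > (0 : ℝ), ∀ Y : EuclideanSpace ℝ (Fin n), ⟪Y, N⟫_ℝ = 0 → μ * ‖Y‖ ^ 2 ≤ q Y := by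
  have hcont : Continuous fun x => q x := by
    have h1 : Continuous (LinearMap.toContinuousLinearMap.toLinearMap ∘ₗ
        QuadraticMap.associated (R := ℝ) q) := LinearMap.continuous_of_finiteDimensional _
    have h2 := h1.clm_apply continuous_id
    exact h2.congr fun x => QuadraticMap.associated_eq_self_apply ℝ q x
  have hS : IsCompact (sphere (0 : EuclideanSpace ℝ (Fin n)) 1 ∩ {Y | ⟪Y, N⟫_ℝ = 0}) :=
    (isCompact_sphere _ _).inter_right (isClosed_eq (by fun_prop) continuous_const)
  have hmain : ∃ μ > (0 : ℝ), ∀ Y ∈ sphere (0 : EuclideanSpace ℝ (Fin n)) 1 ∩ {Y | ⟪Y, N⟫_ℝ = 0},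
      μ ≤ q Y := by
    rcases (sphere (0 : EuclideanSpace ℝ (Fin n)) 1 ∩ {Y | ⟪Y, N⟫_ℝ = 0}).eq_empty_or_nonempty
      with he | hne
    · exact ⟨1, one_pos, by simp [he]⟩
    · obtain ⟨Z, hZ, hmin⟩ := hS.exists_isMinOn hne hcont.continuousOn
      refine ⟨q Z, hq Z hZ.2 ?_, fun Y hY => hmin hY⟩
      rintro rfl
      simpa using hZ.1
  obtain ⟨μ, hμ, hle⟩ := hmain
  refine ⟨μ, hμ, fun Y hY => ?_⟩
  by_cases h : Y = 0
  · simp [h]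
  have hn : 0 < ‖Y‖ := norm_pos_iff.2 h
  have := hle (‖Y‖⁻¹ • Y) ⟨by simp [norm_smul, hn.ne'], by simp [inner_smul_left, hY]⟩
  rw [QuadraticMap.map_smul, smul_eq_mul] at this
  have h3 : q Y = ‖Y‖ ^ 2 * (‖Y‖⁻¹ * ‖Y‖⁻¹ * q Y) := by field_simp
  rw [h3, mul_comm]
  gcongr

/-- The Pythagorean identity for a vector split along a unit vector and its orthogonal. -/
theorem norm_add_smul_sq {n : ℕ} {N Y : EuclideanSpace ℝ (Fin n)} (hN : ‖N‖ = 1)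
    (hY : ⟪Y, N⟫_ℝ = 0) (y : ℝ) : ‖Y + y • N‖ ^ 2 = ‖Y‖ ^ 2 + y ^ 2 := by
  rw [norm_add_sq_real, inner_smul_right, hY, norm_smul, hN]
  simp

theorem inner_add_smul_unit {n : ℕ} {N Y : EuclideanSpace ℝ (Fin n)} (hN : ‖N‖ = 1)
    (hY : ⟪Y, N⟫_ℝ = 0) (y : ℝ) : ⟪Y + y • N, N⟫_ℝ = y := by
  simp [inner_add_left, inner_smul_left, hY, hN]

/-- Below every point of a closed set lying above the hyperplane `X₀ + N^⊥` there is a frontier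
point. -/
theorem exists_frontier_below {n : ℕ} {K : Set (EuclideanSpace ℝ (Fin n))} (hK : IsClosed K)
    {X₀ N Y : EuclideanSpace ℝ (Fin n)} (hN : ‖N‖ = 1) (hsupp : ∀ x ∈ K, 0 ≤ ⟪x - X₀, N⟫_ℝ)
    (hY : ⟪Y, N⟫_ℝ = 0) {y : ℝ} (hy : X₀ + Y + y • N ∈ K) :
    ∃ y', 0 ≤ y' ∧ y' ≤ y ∧ X₀ + Y + y' • N ∈ frontier K := by
  set S : Set ℝ := {t | X₀ + Y + t • N ∈ K} with hSdef
  have hcont : Continuous fun t : ℝ => X₀ + Y + t • N := by fun_prop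
  have hS : IsClosed S := hK.preimage hcont
  have hlow : ∀ t ∈ S, 0 ≤ t := fun t ht => by
    have := hsupp _ ht
    rwa [show X₀ + Y + t • N - X₀ = Y + t • N by abel, inner_add_smul_unit hN hY] at this
  have hbdd : BddBelow S := ⟨0, hlow⟩
  have hmem : sInf S ∈ S := hS.csInf_mem ⟨y, hy⟩ hbdd
  refine ⟨sInf S, hlow _ hmem, csInf_le hbdd hy, subset_closure hmem, fun hint => ?_⟩
  have hev : ∀ᶠ t in 𝓝 (sInf S), t ∈ S :=
    hcont.continuousAt.eventually (mem_interior_iff_mem_nhds.1 hint)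
  obtain ⟨t, ht, htS⟩ := ((hev.filter_mono nhdsWithin_le_nhds).and
    (self_mem_nhdsWithin : Iio (sInf S) ∈ 𝓝[<] (sInf S))).exists
  exact absurd (csInf_le hbdd ht) (not_le.2 htS)

/-- If the points of a convex set `K` near `X₀` lie above a paraboloid, then the points of `K` away
from `X₀` lie above a cone. -/
theorem exists_cone_bound {n : ℕ} {K : Set (EuclideanSpace ℝ (Fin n))} (hK : Convex ℝ K)
    {X₀ N : EuclideanSpace ℝ (Fin n)} (hX₀ : X₀ ∈ K) (hN : ‖N‖ = 1) {ν ρ : ℝ} (hν : 0 < ν)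
    (hρ : 0 < ρ)
    (hpar : ∀ (Y : EuclideanSpace ℝ (Fin n)) (y : ℝ), ⟪Y, N⟫_ℝ = 0 → X₀ + Y + y • N ∈ K →
      ‖Y + y • N‖ ≤ ρ → 0 ≤ y ∧ ν * ‖Y‖ ^ 2 ≤ y) :
    ∃ κ > (0 : ℝ), ∀ (Y : EuclideanSpace ℝ (Fin n)) (y : ℝ), ⟪Y, N⟫_ℝ = 0 →
      X₀ + Y + y • N ∈ K → ρ ≤ ‖Y + y • N‖ → κ * ‖Y + y • N‖ ≤ y := by
  refine ⟨min (1 / 2) (ν * (3 / 4) * ρ), by positivity, fun Y y hY hX hfar => ?_⟩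
  set d := ‖Y + y • N‖ with hd
  have hdpos : 0 < d := hρ.trans_le hfar
  set l := ρ / d with hl
  have hl0 : 0 < l := by positivity
  have hl1 : l ≤ 1 := (div_le_one hdpos).2 hfar
  have hsplit : l • Y + (l * y) • N = l • (Y + y • N) := by rw [smul_add, smul_smul]
  have hnorm : ‖l • Y + (l * y) • N‖ = ρ := by
    rw [hsplit, norm_smul, Real.norm_of_nonneg hl0.le, ← hd, hl]
    field_simp
  have hlY : ⟪l • Y, N⟫_ℝ = 0 := by simp [inner_smul_left, hY]
  have hmem : X₀ + l • Y + (l * y) • N ∈ K := by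
    have h := hK.add_smul_sub_mem hX₀ hX ⟨hl0.le, hl1⟩
    rwa [show X₀ + Y + y • N - X₀ = Y + y • N by abel, ← hsplit, ← add_assoc] at h
  obtain ⟨h0, h1⟩ := hpar _ _ hlY hmem hnorm.le
  have hsq := norm_add_smul_sq hN hlY (l * y)
  rw [hnorm] at hsq
  have hkey : min (1 / 2) (ν * (3 / 4) * ρ) * ρ ≤ l * y := by
    by_cases hc : ρ / 2 ≤ l * y
    · nlinarith [min_le_left (1 / 2) (ν * (3 / 4) * ρ)]
    · have h2 : (l * y) ^ 2 ≤ (ρ / 2) ^ 2 := by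
        have := (not_le.1 hc).le
        gcongr
      have h3 : ν * (3 / 4 * ρ ^ 2) ≤ ν * ‖l • Y‖ ^ 2 := by
        gcongr
        linarith
      nlinarith [min_le_right (1 / 2) (ν * (3 / 4) * ρ)]
  have : ρ = l * d := by rw [hl]; field_simp
  refine le_of_mul_le_mul_left ?_ hl0
  calc l * (min (1 / 2) (ν * (3 / 4) * ρ) * d) = min (1 / 2) (ν * (3 / 4) * ρ) * (l * d) := by ring
    _ ≤ l * y := by rwa [← this]

/-- The linear functional `polar q v` on `N^⊥` is represented by a vector of `N^⊥`. -/
theorem exists_inner_eq_polar {n : ℕ} {N : EuclideanSpace ℝ (Fin n)} (hN : ‖N‖ = 1)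
    (q : QuadraticForm ℝ (EuclideanSpace ℝ (Fin n))) (v : EuclideanSpace ℝ (Fin n)) :
    ∃ w : EuclideanSpace ℝ (Fin n), ⟪N, w⟫_ℝ = 0 ∧
      ∀ Y : EuclideanSpace ℝ (Fin n), ⟪Y, N⟫_ℝ = 0 → ⟪Y, w⟫_ℝ = q (v + Y) - q v - q Y := by
  set w₀ := (InnerProductSpace.toDual ℝ (EuclideanSpace ℝ (Fin n))).symm
    (LinearMap.toContinuousLinearMap (QuadraticMap.polarBilin q v)) with hw₀
  have h₀ : ∀ Y, ⟪Y, w₀⟫_ℝ = q (v + Y) - q v - q Y := fun Y => by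
    rw [real_inner_comm, hw₀, InnerProductSpace.toDual_symm_apply]
    rfl
  refine ⟨w₀ - ⟪N, w₀⟫_ℝ • N, ?_, fun Y hY => ?_⟩
  · simp [inner_sub_right, inner_smul_right, hN]
  · rw [inner_sub_right, inner_smul_right, hY, mul_zero, sub_zero, h₀]

/-- A vector which nearly lies on the tangent hyperplane of `q` at `s • v` is close to `s • v`. -/
theorem norm_sub_smul_le_of_tangent {n : ℕ} {N P Y : EuclideanSpace ℝ (Fin n)}
    {q : QuadraticForm ℝ (EuclideanSpace ℝ (Fin n))} {μ ε s : ℝ} (hμ : 0 < μ)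
    (hμq : ∀ Y : EuclideanSpace ℝ (Fin n), ⟪Y, N⟫_ℝ = 0 → μ * ‖Y‖ ^ 2 ≤ q Y)
    (hP : ⟪P, N⟫_ℝ = 0) (hY : ⟪Y, N⟫_ℝ = 0) (hs : 0 < s) (hε : 0 < ε) (hε4 : ε ≤ 1 / 4)
    (hεP : 8 * ε * q P ≤ μ * (‖P‖ ^ 2 / 4))
    (h : (1 - ε) * q Y ≤ s * (q (P + Y) - q P - q Y) - s ^ 2 * (q P - 2 * ε * q P)) :
    ‖Y - s • P‖ ≤ s * (‖P‖ / 2) := by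
  have hpol : ∀ a b, QuadraticMap.polar q a b = q (a + b) - q a - q b := fun _ _ => rfl
  have hsP : q (s • P) = s ^ 2 * q P := by rw [QuadraticMap.map_smul, smul_eq_mul]; ring
  have hp : q (s • P + Y) - q (s • P) - q Y = s * (q (P + Y) - q P - q Y) := by
    rw [← hpol, ← hpol, QuadraticMap.polar_smul_left, smul_eq_mul]
  have hpar : q (Y - s • P) + q (s • P + Y) = 2 * q Y + 2 * q (s • P) := by
    have h1 := hpol Y (-(s • P))
    have h2 := hpol Y (s • P)
    rw [QuadraticMap.polar_neg_right, QuadraticMap.map_neg, ← sub_eq_add_neg] at h1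
    rw [add_comm Y] at h2
    linarith
  have hperp : ⟪Y - s • P, N⟫_ℝ = 0 := by simp [inner_sub_left, inner_smul_left, hP, hY]
  have hlow := hμq _ hperp
  have hplus : 0 ≤ q (s • P + Y) + q (s • P + Y) := by
    have : ⟪s • P + Y, N⟫_ℝ = 0 := by simp [inner_add_left, inner_smul_left, hP, hY]
    have := hμq _ this
    have : 0 ≤ μ * ‖s • P + Y‖ ^ 2 := by positivity
    linarith
  have htwo : q Y ≤ 2 * q (Y - s • P) + 2 * q (s • P) := by
    have hadd : ⟪(Y - s • P) - s • P, N⟫_ℝ = 0 := by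
      simp [inner_sub_left, inner_smul_left, hP, hY]
    have h1 := hpol (Y - s • P) (-(s • P))
    have h2 := hpol (Y - s • P) (s • P)
    rw [QuadraticMap.polar_neg_right, QuadraticMap.map_neg, ← sub_eq_add_neg] at h1
    rw [sub_add_cancel] at h2
    have h3 := hμq _ hadd
    have : 0 ≤ μ * ‖(Y - s • P) - s • P‖ ^ 2 := by positivity
    linarith
  have h0 : 0 ≤ q (Y - s • P) := le_trans (by positivity) hlow
  have hub : q (Y - s • P) ≤ s ^ 2 * (8 * ε * q P) := by
    nlinarith [mul_le_mul_of_nonneg_left htwo hε.le, mul_le_mul_of_nonneg_right hε4 h0]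
  have hfin : μ * ‖Y - s • P‖ ^ 2 ≤ μ * (s * (‖P‖ / 2)) ^ 2 := by
    nlinarith [mul_le_mul_of_nonneg_left hεP (sq_nonneg s)]
  exact le_of_sq_le_sq (le_of_mul_le_mul_left hfin hμ) (by positivity)

/-- A displacement from `X₀ = -V + c • N` that is close to `s • V` along `N^⊥` and of order `s ^ 2`
along `N` decreases the norm. -/
theorem norm_add_lt_of_norm_sub_smul_le {n : ℕ} {X₀ N V Y w : EuclideanSpace ℝ (Fin n)}
    {c s y : ℝ} (hN : ‖N‖ = 1) (hYN : ⟪Y, N⟫_ℝ = 0) (hc : c = ⟪X₀, N⟫_ℝ)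
    (hXV : X₀ = -V + c • N) (hcneg : c ≤ 0) (hs : 0 < s)
    (hsn : 4 * s * ‖V‖ ^ 2 + 4 * ‖w‖ ^ 2 * ‖V‖ ^ 2 * s ^ 3 < ‖V‖ ^ 2) (hy0 : 0 ≤ y)
    (hyup : y ≤ s * (‖Y‖ * ‖w‖)) (hclose : ‖Y - s • V‖ ≤ s * (‖V‖ / 2)) :
    ‖X₀ + Y + y • N‖ < ‖X₀‖ := by
  have hYnorm : ‖Y‖ ≤ 2 * s * ‖V‖ := by
    have h1 : ‖Y‖ ≤ ‖Y - s • V‖ + ‖s • V‖ := by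
      simpa using norm_add_le (Y - s • V) (s • V)
    rw [norm_smul, Real.norm_of_nonneg hs.le] at h1
    have : 0 ≤ s * ‖V‖ := by positivity
    linarith
  have hYV : s * (‖V‖ ^ 2 / 2) ≤ ⟪V, Y⟫_ℝ := by
    have h1 : ⟪V, s • V - Y⟫_ℝ ≤ ‖V‖ * (s * (‖V‖ / 2)) :=
      (real_inner_le_norm _ _).trans (by rw [norm_sub_rev]; gcongr)
    rw [inner_sub_right, inner_smul_right, real_inner_self_eq_norm_sq] at h1
    linarith
  have hyup' : y ≤ 2 * ‖w‖ * ‖V‖ * s ^ 2 := by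
    have : s * (‖Y‖ * ‖w‖) ≤ s * (2 * s * ‖V‖ * ‖w‖) := by gcongr
    linarith
  have hysq : y ^ 2 ≤ (2 * ‖w‖ * ‖V‖ * s ^ 2) ^ 2 := by gcongr
  have hYsq : ‖Y‖ ^ 2 ≤ (2 * s * ‖V‖) ^ 2 := by gcongr
  have hexp : ‖X₀ + Y + y • N‖ ^ 2 =
      ‖X₀‖ ^ 2 + 2 * (c * y - ⟪V, Y⟫_ℝ) + (‖Y‖ ^ 2 + y ^ 2) := by
    have hin : ⟪X₀, Y + y • N⟫_ℝ = c * y - ⟪V, Y⟫_ℝ := by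
      have hNY : ⟪N, Y⟫_ℝ = 0 := by rw [real_inner_comm, hYN]
      rw [inner_add_right, inner_smul_right, ← hc, hXV, inner_add_left, inner_smul_left, hNY]
      simp
      ring
    rw [add_assoc, norm_add_sq_real, norm_add_smul_sq hN hYN, hin]
  refine lt_of_pow_lt_pow_left₀ 2 (norm_nonneg _) ?_
  rw [hexp]
  have hcy : c * y ≤ 0 := mul_nonpos_of_nonpos_of_nonneg hcneg hy0
  have := mul_lt_mul_of_pos_left hsn hs
  linarith

/-- **Lemma 7 (Meyer–Reisner).** If `0 ∈ int K`, `∂K` has positive generalized curvature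
at `X₀` and the outer normal at `X₀` is not parallel to `X₀`, then some cap of `K` with
nonempty interior lies strictly inside the ball of radius `|X₀|`. -/
theorem exists_cap_of_not_parallel_normal {n : ℕ}
    (K : Set (EuclideanSpace ℝ (Fin n))) (hK : IsConvexBody K)
    (h0 : (0 : EuclideanSpace ℝ (Fin n)) ∈ interior K)
    (X₀ : EuclideanSpace ℝ (Fin n)) (hX₀ : X₀ ∈ frontier K)
    (hcurv : HasPosGenCurvature K X₀)
    (hnotpar : ∀ N : EuclideanSpace ℝ (Fin n), ‖N‖ = 1 →
      (∀ X ∈ K, ⟪X, N⟫_ℝ ≤ ⟪X₀, N⟫_ℝ) → ∀ t : ℝ, N ≠ t • X₀) :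
    ∃ u : EuclideanSpace ℝ (Fin n), ‖u‖ = 1 ∧ ∃ α > (0 : ℝ),
      (interior {X ∈ K | α ≤ ⟪X, u⟫_ℝ}).Nonempty ∧
      ∀ X ∈ K, α ≤ ⟪X, u⟫_ℝ → ‖X‖ < ‖X₀‖ := by
  obtain ⟨hKc, hKconv, hKint⟩ := hK
  obtain ⟨N, q, hN, hsupp, hqpos, hcur⟩ := hcurv
  have hKcl : IsClosed K := hKc.isClosed
  have hX₀K : X₀ ∈ K := hKcl.frontier_subset hX₀
  have h0K : (0 : EuclideanSpace ℝ (Fin n)) ∈ K := interior_subset h0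
  obtain ⟨c, hc⟩ : ∃ c, c = ⟪X₀, N⟫_ℝ := ⟨_, rfl⟩
  obtain ⟨V, hV⟩ : ∃ V, V = c • N - X₀ := ⟨_, rfl⟩
  have hVN : ⟪V, N⟫_ℝ = 0 := by simp [hV, inner_sub_left, inner_smul_left, hN, hc]
  have hXV : X₀ = -V + c • N := by rw [hV]; abel
  have hV0 : V ≠ 0 := by
    intro h
    have hX : X₀ = c • N := by rw [hXV, h]; simp
    have hc0 : c ≠ 0 := by
      rintro rfl
      rw [zero_smul] at hX
      exact hX₀.2 (hX ▸ h0)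
    refine hnotpar (-N) (by simpa using hN) (fun X hX => ?_) (-c⁻¹) ?_
    · have := hsupp X hX
      rw [inner_sub_left] at this
      simpa using this
    · rw [hX, smul_smul]
      simp [hc0]
  have hcneg : c < 0 := by
    have hev : ∀ᶠ t : ℝ in 𝓝 0, t • N ∈ K := by
      have hcont : Continuous fun t : ℝ => t • N := by fun_prop
      refine hcont.continuousAt.eventually (mem_interior_iff_mem_nhds.1 ?_)
      simpa using h0
    obtain ⟨t, ht, htneg⟩ := ((hev.filter_mono nhdsWithin_le_nhds).and
      (self_mem_nhdsWithin : Iio (0 : ℝ) ∈ 𝓝[<] 0)).exists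
    have h := hsupp _ ht
    rw [inner_sub_left, inner_smul_left, ← hc] at h
    simp [hN] at h
    exact h.trans_lt htneg
  obtain ⟨μ, hμ, hμq⟩ := exists_pos_mul_norm_sq_le N q hqpos
  have hQ : 0 < q V := hqpos V hVN hV0
  have hVn : 0 < ‖V‖ := norm_pos_iff.2 hV0
  obtain ⟨ε, hε, hε4, hεV⟩ : ∃ ε > (0 : ℝ), ε ≤ 1 / 4 ∧ 8 * ε * q V ≤ μ * (‖V‖ ^ 2 / 4) := by
    refine ⟨min (1 / 4) (μ * (‖V‖ ^ 2 / 4) / (8 * q V)), by positivity, min_le_left _ _, ?_⟩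
    have := min_le_right (1 / 4) (μ * (‖V‖ ^ 2 / 4) / (8 * q V))
    rw [le_div_iff₀ (by positivity)] at this
    linarith
  obtain ⟨a, ha, hcura⟩ := hcur ε hε
  have hpara : ∀ (Y : EuclideanSpace ℝ (Fin n)) (y : ℝ), ⟪Y, N⟫_ℝ = 0 → X₀ + Y + y • N ∈ K →
      ‖Y + y • N‖ < a → ∃ y', 0 ≤ y' ∧ y' ≤ y ∧ X₀ + Y + y' • N ∈ K ∧
        (1 - ε) * q Y ≤ y' ∧ y' ≤ (1 + ε) * q Y := by
    intro Y y hY hX hlt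
    obtain ⟨y', h0', hle, hfr⟩ := exists_frontier_below hKcl hN hsupp hY hX
    refine ⟨y', h0', hle, hKcl.frontier_subset hfr, hcura Y y' hY ⟨hfr, ?_⟩⟩
    rw [mem_ball, dist_eq_norm, show X₀ + Y + y' • N - X₀ = Y + y' • N by abel]
    refine lt_of_le_of_lt (le_of_sq_le_sq ?_ (norm_nonneg _)) hlt
    rw [norm_add_smul_sq hN hY, norm_add_smul_sq hN hY]
    gcongr
  obtain ⟨κ, hκ, hcone⟩ := exists_cone_bound hKconv hX₀K hN (ν := (1 - ε) * μ) (ρ := a / 2)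
    (mul_pos (by linarith) hμ) (by positivity) (fun Y y hY hX hle => by
      obtain ⟨y', h0', hy', -, h1, -⟩ := hpara Y y hY hX (by linarith)
      refine ⟨h0'.trans hy', ?_⟩
      have := mul_le_mul_of_nonneg_left (hμq Y hY) (show 0 ≤ 1 - ε by linarith)
      linarith)
  obtain ⟨w, hNw, hw⟩ := exists_inner_eq_polar hN q V
  obtain ⟨s, hs, hs1, hsa, hsκ, hsα, hsn⟩ : ∃ s : ℝ, 0 < s ∧ s < 1 ∧ s * ‖X₀‖ < a ∧
      s * ‖w‖ < κ ∧ 0 < s * ⟪X₀, w⟫_ℝ - c ∧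
      4 * s * ‖V‖ ^ 2 + 4 * ‖w‖ ^ 2 * ‖V‖ ^ 2 * s ^ 3 < ‖V‖ ^ 2 := by
    have e : ∀ (f : ℝ → ℝ) (b : ℝ), Continuous f → f 0 < b → ∀ᶠ s in 𝓝[>] (0 : ℝ), f s < b :=
      fun f b hf hb => (hf.continuousAt.eventually_lt_const hb).filter_mono nhdsWithin_le_nhds
    have e0 : ∀ᶠ s in 𝓝[>] (0 : ℝ), 0 < s := self_mem_nhdsWithin
    have e1 := e (fun s => s) 1 (by fun_prop) (by simp)
    have e2 := e (fun s => s * ‖X₀‖) a (by fun_prop) (by simpa)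
    have e3 := e (fun s => s * ‖w‖) κ (by fun_prop) (by simpa)
    have e4 := e (fun s => -(s * ⟪X₀, w⟫_ℝ - c)) 0 (by fun_prop) (by simpa)
    have e5 := e (fun s => 4 * s * ‖V‖ ^ 2 + 4 * ‖w‖ ^ 2 * ‖V‖ ^ 2 * s ^ 3) (‖V‖ ^ 2)
      (by fun_prop) (by simpa using pow_pos hVn 2)
    obtain ⟨s, h0, h1, h2, h3, h4, h5⟩ := (e0.and
      (e1.and (e2.and (e3.and (e4.and e5))))).exists
    exact ⟨s, h0, h1, h2, h3, by linarith, h5⟩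
  obtain ⟨U, hU⟩ : ∃ U, U = s • w - N := ⟨_, rfl⟩
  have hUin : ∀ (Y : EuclideanSpace ℝ (Fin n)) (y : ℝ), ⟪Y, N⟫_ℝ = 0 →
      ⟪X₀ + Y + y • N, U⟫_ℝ = ⟪X₀, U⟫_ℝ + (s * ⟪Y, w⟫_ℝ - y) := fun Y y hY => by
    rw [add_assoc, inner_add_left, hU]
    simp [inner_add_left, inner_sub_right, inner_smul_left, inner_smul_right, hY, hNw, hN]
  have hX₀U : ⟪X₀, U⟫_ℝ = s * ⟪X₀, w⟫_ℝ - c := by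
    rw [hU, inner_sub_right, inner_smul_right, ← hc]
  obtain ⟨β, hβ⟩ : ∃ β, β = ⟪X₀, U⟫_ℝ + s ^ 2 * (q V - 2 * ε * q V) := ⟨_, rfl⟩
  have hgap : 0 ≤ s ^ 2 * (q V - 2 * ε * q V) := by
    have : 0 ≤ q V - 2 * ε * q V := by nlinarith
    positivity
  have hβpos : 0 < β := by rw [hβ]; linarith
  have hU0 : 0 < ‖U‖ := by
    refine norm_pos_iff.2 fun h => ?_
    rw [h, inner_zero_right] at hX₀U
    linarith
  have hcap : ∀ X, β / ‖U‖ ≤ ⟪X, ‖U‖⁻¹ • U⟫_ℝ ↔ β ≤ ⟪X, U⟫_ℝ := fun X => by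
    rw [inner_smul_right, div_eq_inv_mul, mul_le_mul_iff_right₀ (by positivity)]
  refine ⟨‖U‖⁻¹ • U, by simp [norm_smul, hU0.ne'], β / ‖U‖, by positivity, ?_, ?_⟩
  · have hsV : ⟪s • V, N⟫_ℝ = 0 := by simp [inner_smul_left, hVN]
    have hray : X₀ + s • V + (-(s * c)) • N = X₀ + s • (0 - X₀) := by
      conv_rhs => rw [hXV]
      conv_lhs => rw [hXV]
      module
    have hrayK : X₀ + s • V + (-(s * c)) • N ∈ K := by
      rw [hray]
      exact hKconv.add_smul_sub_mem hX₀K h0K ⟨hs.le, hs1.le⟩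
    have hlen : ‖s • V + (-(s * c)) • N‖ < a := by
      have : s • V + (-(s * c)) • N = -(s • X₀) := by
        rw [hXV]
        module
      rwa [this, norm_neg, norm_smul, Real.norm_of_nonneg hs.le]
    obtain ⟨y', -, -, hK', -, hup⟩ := hpara _ _ hsV hrayK hlen
    have hstrict : β < ⟪X₀ + s • V + y' • N, U⟫_ℝ := by
      have hqs : q (s • V) = s ^ 2 * q V := by rw [QuadraticMap.map_smul, smul_eq_mul]; ring
      have hqd : q (V + V) = 4 * q V := by
        rw [← two_smul ℝ V, QuadraticMap.map_smul, smul_eq_mul]; ring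
      rw [hUin _ _ hsV, hβ, inner_smul_left, hw V hVN, hqd]
      rw [hqs] at hup
      simp only [conj_trivial]
      have : 0 < s ^ 2 * (ε * q V) := by positivity
      nlinarith
    have hopen : IsOpen {X : EuclideanSpace ℝ (Fin n) | β < ⟪X, U⟫_ℝ} :=
      isOpen_lt continuous_const (by fun_prop)
    have hclos : X₀ + s • V + y' • N ∈ closure (interior K) := by
      rw [hKconv.closure_interior_eq_closure_of_nonempty_interior hKint]
      exact subset_closure hK'
    obtain ⟨Z, hZU, hZK⟩ := mem_closure_iff.1 hclos _ hopen hstrict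
    refine ⟨Z, mem_interior.2 ⟨_, ?_, hopen.inter isOpen_interior, hZU, hZK⟩⟩
    exact fun T hT => ⟨interior_subset hT.2, (hcap T).2 (le_of_lt hT.1)⟩
  · intro X hXK hXcap
    rw [hcap] at hXcap
    obtain ⟨y, hy⟩ : ∃ y, y = ⟪X - X₀, N⟫_ℝ := ⟨_, rfl⟩
    obtain ⟨Y, hYdef⟩ : ∃ Y, Y = X - X₀ - y • N := ⟨_, rfl⟩
    have hYN : ⟪Y, N⟫_ℝ = 0 := by
      rw [hYdef, inner_sub_left, ← hy, inner_smul_left]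
      simp [hN]
    obtain rfl : X = X₀ + Y + y • N := by rw [hYdef]; abel
    have hy0 : 0 ≤ y := hy ▸ hsupp _ hXK
    rw [hUin Y y hYN, hβ] at hXcap
    have hcs : ⟪Y, w⟫_ℝ ≤ ‖Y‖ * ‖w‖ := real_inner_le_norm _ _
    have hYle : ‖Y‖ ≤ ‖Y + y • N‖ := by
      refine le_of_sq_le_sq ?_ (norm_nonneg _)
      rw [norm_add_smul_sq hN hYN]
      nlinarith
    have hyup : y ≤ s * (‖Y‖ * ‖w‖) := by
      have := mul_le_mul_of_nonneg_left hcs hs.le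
      linarith
    have hnear : ‖Y + y • N‖ < a := by
      by_contra hfar
      have hfar' : a / 2 ≤ ‖Y + y • N‖ := by linarith
      have h1 := hcone Y y hYN hXK hfar'
      have h2 : s * (‖Y‖ * ‖w‖) ≤ s * ‖w‖ * ‖Y + y • N‖ := by
        rw [mul_comm ‖Y‖, ← mul_assoc]
        gcongr
      have h3 : s * ‖w‖ * ‖Y + y • N‖ < κ * ‖Y + y • N‖ :=
        mul_lt_mul_of_pos_right hsκ (by linarith)
      linarith
    obtain ⟨y', -, hy', -, hlow, -⟩ := hpara Y y hYN hXK hnear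
    have hclose := norm_sub_smul_le_of_tangent hμ hμq hVN hYN hs hε hε4 hεV
      (by rw [← hw Y hYN]; linarith)
    exact norm_add_lt_of_norm_sub_smul_le hN hYN hc hXV hcneg.le hs hsn hy0 hyup hclose
end
end

section
/- Let K ⊂ ℝⁿ be an isotropic convex body that is a local maximizer for the isotropy constant L (with respect to Hausdorff distance), and suppose ∂K has positive generalized Gauss curvature at a point X₀ ∈ ∂K. Then the outer normal of K at X₀ is parallel to the vector X₀, i.e. the outer unit normal equals X₀/|X₀|. -/
open MeasureTheory Metric Set Filter
open scoped InnerProductSpace Topology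

noncomputable section

lemma Matrix.sum_sum_sign_mul_prod {n : ℕ} (A : Matrix (Fin n) (Fin n) ℝ) :
    ∑ σ : Equiv.Perm (Fin n), ∑ τ : Equiv.Perm (Fin n),
      ((Equiv.Perm.sign σ : ℤ) : ℝ) * ((Equiv.Perm.sign τ : ℤ) : ℝ) * ∏ i, A (σ i) (τ i)
      = (n.factorial : ℝ) * A.det := by
  rw [Finset.sum_comm]
  have key : ∀ τ : Equiv.Perm (Fin n), ∑ σ : Equiv.Perm (Fin n),
      ((Equiv.Perm.sign σ : ℤ) : ℝ) * ((Equiv.Perm.sign τ : ℤ) : ℝ) * ∏ i, A (σ i) (τ i)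
      = A.det := by
    intro τ
    have h1 := Matrix.det_permute' τ A
    rw [Matrix.det_apply'] at h1
    simp only [Matrix.submatrix_apply, id] at h1
    have h2 : ((Equiv.Perm.sign τ : ℤ) : ℝ) * ((Equiv.Perm.sign τ : ℤ) : ℝ) = 1 := by
      rw [← Int.cast_mul, Int.units_coe_mul_self]; simp
    calc _ = ((Equiv.Perm.sign τ : ℤ) : ℝ) *
          ∑ σ : Equiv.Perm (Fin n), ((Equiv.Perm.sign σ : ℤ) : ℝ) * ∏ i, A (σ i) (τ i) := by
          rw [Finset.mul_sum]; exact Finset.sum_congr rfl fun σ _ => by ring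
      _ = _ := by rw [h1, ← mul_assoc, h2, one_mul]
  rw [Finset.sum_congr rfl fun τ _ => key τ]
  simp [Fintype.card_perm]

/-- Andréief's identity for the second moment matrix. -/
lemma detInt_eq_det {n : ℕ} {K : Set (EuclideanSpace ℝ (Fin n))} (hK : IsCompact K)
    (g : EuclideanSpace ℝ (Fin n)) :
    detInt K g = (Matrix.of fun i j : Fin n => ∫ x in K, (x i - g i) * (x j - g j)).det := by
  have hint : ∀ i j : Fin n, IntegrableOn
      (fun x : EuclideanSpace ℝ (Fin n) => (x i - g i) * (x j - g j)) K := fun i j =>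
    ContinuousOn.integrableOn_compact hK (by fun_prop)
  have hexp : ∀ X : Fin n → EuclideanSpace ℝ (Fin n),
      (Matrix.det (Matrix.of fun i j : Fin n => X j i - g i)) ^ 2 =
      ∑ σ : Equiv.Perm (Fin n), ∑ τ : Equiv.Perm (Fin n),
      ((Equiv.Perm.sign σ : ℤ) : ℝ) * ((Equiv.Perm.sign τ : ℤ) : ℝ) *
        ∏ k, (X k (σ k) - g (σ k)) * (X k (τ k) - g (τ k)) := by
    intro X
    rw [sq, Matrix.det_apply', Finset.sum_mul_sum]
    refine Finset.sum_congr rfl fun σ _ => Finset.sum_congr rfl fun τ _ => ?_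
    simp only [Matrix.of_apply, Finset.prod_mul_distrib]
    ring
  have hprod : ∀ σ τ : Equiv.Perm (Fin n), Integrable
      (fun X : Fin n → EuclideanSpace ℝ (Fin n) =>
        ∏ k, (X k (σ k) - g (σ k)) * (X k (τ k) - g (τ k)))
      (Measure.pi fun _ : Fin n => volume.restrict K) := by
    intro σ τ
    exact Integrable.fintype_prod
      (f := fun k (x : EuclideanSpace ℝ (Fin n)) => (x (σ k) - g (σ k)) * (x (τ k) - g (τ k)))
      fun k => hint (σ k) (τ k)
  have hn : (n.factorial : ℝ) ≠ 0 := by positivity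
  unfold detInt
  rw [Measure.restrict_pi_pi]
  simp_rw [hexp]
  rw [integral_finsetSum _ fun σ _ => integrable_finsetSum _ fun τ _ => (hprod σ τ).const_mul _]
  have : ∀ σ : Equiv.Perm (Fin n), ∫ X : Fin n → EuclideanSpace ℝ (Fin n),
      ∑ τ : Equiv.Perm (Fin n), ((Equiv.Perm.sign σ : ℤ) : ℝ) * ((Equiv.Perm.sign τ : ℤ) : ℝ) *
        ∏ k, (X k (σ k) - g (σ k)) * (X k (τ k) - g (τ k))
        ∂(Measure.pi fun _ : Fin n => volume.restrict K) =
      ∑ τ : Equiv.Perm (Fin n), ((Equiv.Perm.sign σ : ℤ) : ℝ) * ((Equiv.Perm.sign τ : ℤ) : ℝ) *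
        ∏ k, (Matrix.of fun i j : Fin n => ∫ x in K, (x i - g i) * (x j - g j)) (σ k) (τ k) := by
    intro σ
    rw [integral_finsetSum _ fun τ _ => (hprod σ τ).const_mul _]
    refine Finset.sum_congr rfl fun τ _ => ?_
    rw [integral_const_mul]
    congr 1
    exact integral_fintype_prod_eq_prod
      (fun k (x : EuclideanSpace ℝ (Fin n)) => (x (σ k) - g (σ k)) * (x (τ k) - g (τ k)))
  rw [Finset.sum_congr rfl fun σ _ => this σ, Matrix.sum_sum_sign_mul_prod, ← mul_assoc,
    inv_mul_cancel₀ hn, one_mul]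

/-- The second order expansion of the determinant at the identity. -/
lemma Matrix.abs_det_one_add_sub_le (n : ℕ) : ∃ C > (0 : ℝ), ∃ r > (0 : ℝ),
    ∀ (A : Matrix (Fin n) (Fin n) ℝ) (V : ℝ), 0 ≤ V → V < r → (∀ i j, |A i j| ≤ V) →
      |(1 + A).det - 1 - A.trace| ≤ C * V ^ 2 := by
  set f : (Fin n → Fin n → ℝ) → ℝ := fun A => (1 + Matrix.of A).det with hf
  have hana : AnalyticAt ℝ f 0 := by
    have : f = fun A => ∑ σ : Equiv.Perm (Fin n), ((Equiv.Perm.sign σ : ℤ) : ℝ) *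
        ∏ i, ((1 : Matrix (Fin n) (Fin n) ℝ) (σ i) i + A (σ i) i) := by
      funext A; simp only [hf, Matrix.det_apply']; rfl
    rw [this]
    refine Finset.analyticAt_fun_sum _ fun σ _ => ?_
    refine analyticAt_const.mul (Finset.analyticAt_fun_prod _ fun i _ => ?_)
    refine analyticAt_const.add ?_
    exact ((ContinuousLinearMap.proj (R := ℝ) (φ := fun _ : Fin n => ℝ) i).comp
      (ContinuousLinearMap.proj (R := ℝ) (φ := fun _ : Fin n => Fin n → ℝ) (σ i))).analyticAt 0
  obtain ⟨p, hp⟩ := hana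
  have hO := hp.isBigO_sub_partialSum_pow 2
  have hd := hp.hasFDerivAt
  have hps : ∀ A, p.partialSum 2 A = 1 + (Matrix.of A).trace := by
    intro A
    have h0 : p 0 (fun _ => A) = 1 := by
      rw [hp.coeff_zero]; simp [hf]
    have h1 : p 1 (fun _ => A) = (Matrix.of A).trace := by
      have hl : HasDerivAt (fun t : ℝ => t • A) A 0 := by
        simpa using (hasDerivAt_id (0 : ℝ)).smul_const A
      have hc := hd.comp_hasDerivAt_of_eq (0 : ℝ) hl (by simp)
      have hc2 : HasDerivAt (f ∘ fun t : ℝ => t • A) ((Matrix.of A).trace) 0 := by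
        have he : (f ∘ fun t : ℝ => t • A) = fun t : ℝ => 1 + (Matrix.of A).trace * t +
          Polynomial.eval t (1 + (Polynomial.X : Polynomial ℝ) • (Matrix.of A).map Polynomial.C).det.divX.divX
            * t ^ 2 := by
          funext t
          exact Matrix.det_one_add_smul t (Matrix.of A)
        rw [he]
        have ha := ((hasDerivAt_id (0 : ℝ)).const_mul (Matrix.of A).trace).const_add 1
        have hb := (Polynomial.hasDerivAt
          (1 + (Polynomial.X : Polynomial ℝ) • (Matrix.of A).map Polynomial.C).det.divX.divX
            (0 : ℝ)).mul (hasDerivAt_pow 2 (0 : ℝ))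
        exact (ha.add hb).congr_deriv (by simp)
      have := hc.unique hc2
      rw [← this]
      simp only [continuousMultilinearCurryFin1_apply]
      congr 1
    simp only [FormalMultilinearSeries.partialSum, Finset.sum_range_succ, Finset.sum_range_zero,
      zero_add, h0, h1]
  obtain ⟨C, hC, hb⟩ := hO.exists_pos
  rw [Asymptotics.IsBigOWith] at hb
  obtain ⟨r, hr, hball⟩ := Metric.eventually_nhds_iff_ball.1 hb
  refine ⟨C, hC, r, hr, fun A V hV hVr hA => ?_⟩
  have hn : ‖(fun i j => A i j : Fin n → Fin n → ℝ)‖ ≤ V :=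
    (pi_norm_le_iff_of_nonneg hV).2 fun i => (pi_norm_le_iff_of_nonneg hV).2 fun j => hA i j
  have := hball (fun i j => A i j) (by simpa using hn.trans_lt hVr)
  rw [hps] at this
  simp only [zero_add, Real.norm_eq_abs, abs_pow, abs_norm] at this
  calc |(1 + A).det - 1 - A.trace| = |f (fun i j => A i j) -
        (1 + (Matrix.of fun i j => A i j).trace)| := by
        congr 1; simp only [hf, sub_sub]; rfl
    _ ≤ _ := this
    _ ≤ C * V ^ 2 := by gcongr

lemma isoL_lt_isoL {n : ℕ} (hn : n ≠ 0) {K K' : Set (EuclideanSpace ℝ (Fin n))}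
    (hM : 0 ≤ Mpow2n K) (hv : 0 < (volume K).toReal) (hv' : 0 < (volume K').toReal)
    (h : Mpow2n K * (volume K').toReal ^ (n + 2) < Mpow2n K' * (volume K).toReal ^ (n + 2)) :
    isoL n K < isoL n K' := by
  have key : ∀ L : Set (EuclideanSpace ℝ (Fin n)), 0 ≤ Mpow2n L → 0 < (volume L).toReal →
      isoL n L = (Mpow2n L / (volume L).toReal ^ (n + 2)) ^ ((2 * (n : ℝ)))⁻¹ := by
    intro L hL hLv
    rw [isoL, Real.div_rpow hL (by positivity), ← Real.rpow_natCast, ← Real.rpow_mul hLv.le]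
    push_cast
    rw [div_eq_mul_inv ((n : ℝ) + 2)]
  have hM' : 0 ≤ Mpow2n K' := by
    by_contra hc
    push Not at hc
    have h1 : 0 ≤ Mpow2n K * (volume K').toReal ^ (n + 2) := by positivity
    have h2 : Mpow2n K' * (volume K).toReal ^ (n + 2) < 0 := mul_neg_of_neg_of_pos hc (by positivity)
    linarith
  rw [key K hM hv, key K' hM' hv']
  refine Real.rpow_lt_rpow (by positivity) ?_ (by positivity)
  rw [div_lt_div_iff₀ (by positivity) (by positivity)]
  exact h

lemma Mpow2n_eq_det {n : ℕ} {K : Set (EuclideanSpace ℝ (Fin n))} (hK : IsCompact K)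
    (hv : 0 < (volume K).toReal) :
    Mpow2n K = (Matrix.of fun i j : Fin n => (∫ x in K, x i * x j) -
      (∫ x in K, x i) * (∫ x in K, x j) / (volume K).toReal).det := by
  rw [Mpow2n, detInt_eq_det hK]
  congr 1
  ext i j
  simp only [Matrix.of_apply]
  have hfin : IsFiniteMeasure (volume.restrict K) := ⟨by simpa using hK.measure_lt_top⟩
  have hx : ∀ k : Fin n, IntegrableOn (fun x : EuclideanSpace ℝ (Fin n) => x k) K := fun k =>
    ContinuousOn.integrableOn_compact hK (by fun_prop)
  have hxx : IntegrableOn (fun x : EuclideanSpace ℝ (Fin n) => x i * x j) K :=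
    ContinuousOn.integrableOn_compact hK (by fun_prop)
  have hid : IntegrableOn (fun x : EuclideanSpace ℝ (Fin n) => x) K :=
    ContinuousOn.integrableOn_compact hK (by fun_prop)
  have hg : ∀ k : Fin n, centroid K k = ((volume K).toReal)⁻¹ * ∫ x in K, x k := by
    intro k
    have := (EuclideanSpace.proj (𝕜 := ℝ) k).integral_comp_comm hid
    simp only [centroid, PiLp.smul_apply, smul_eq_mul]
    congr 1
    exact this.symm
  have h1 : ∀ x : EuclideanSpace ℝ (Fin n), (x i - centroid K i) * (x j - centroid K j) =
      x i * x j - centroid K j * x i - centroid K i * x j + centroid K i * centroid K j := by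
    intro x; ring
  simp_rw [h1]
  have i1 : IntegrableOn (fun x : EuclideanSpace ℝ (Fin n) =>
      x i * x j - centroid K j * x i) K := hxx.sub ((hx i).const_mul _)
  have i2 : IntegrableOn (fun x : EuclideanSpace ℝ (Fin n) =>
      x i * x j - centroid K j * x i - centroid K i * x j) K := i1.sub ((hx j).const_mul _)
  rw [integral_add i2 (integrable_const _), integral_sub i1 ((hx j).const_mul _),
    integral_sub hxx ((hx i).const_mul _), integral_const_mul, integral_const_mul,
    integral_const, hg, hg]
  simp only [Measure.real, Measure.restrict_apply MeasurableSet.univ, univ_inter, smul_eq_mul]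
  field_simp
  ring

lemma IsIsotropic.integral_mul {n : ℕ} {K : Set (EuclideanSpace ℝ (Fin n))} {M : ℝ}
    (hK : IsCompact K) (h : IsIsotropic K M) (i j : Fin n) :
    ∫ x in K, x i * x j = M ^ 2 * (1 : Matrix (Fin n) (Fin n) ℝ) i j := by
  obtain ⟨-, -, h⟩ := h
  have hxx : ∀ i j : Fin n, IntegrableOn (fun x : EuclideanSpace ℝ (Fin n) => x i * x j) K :=
    fun i j => ContinuousOn.integrableOn_compact hK (by fun_prop)
  have hii : ∀ k : Fin n, ∫ x in K, x k * x k = M ^ 2 := by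
    intro k
    have := h (EuclideanSpace.single k 1)
    simpa [EuclideanSpace.inner_single_right, sq] using this
  rcases eq_or_ne i j with rfl | hij
  · simp [hii]
  · have := h (EuclideanSpace.single i 1 + EuclideanSpace.single j 1)
    have hn : ‖(EuclideanSpace.single i 1 + EuclideanSpace.single j 1 :
        EuclideanSpace ℝ (Fin n))‖ ^ 2 = 2 := by
      rw [norm_add_sq_real]
      simp [EuclideanSpace.inner_single_right, hij.symm]
      norm_num
    rw [hn] at this
    simp only [inner_add_right, EuclideanSpace.inner_single_right] at this
    have h2 : ∀ x : EuclideanSpace ℝ (Fin n), (1 * (starRingEnd ℝ) (x i) +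
        1 * (starRingEnd ℝ) (x j)) ^ 2 = x i * x i + x j * x j + 2 * (x i * x j) := by
      intro x; simp; ring
    simp_rw [h2] at this
    have h3 : IntegrableOn (fun x : EuclideanSpace ℝ (Fin n) => x i * x i + x j * x j) K :=
      (hxx i i).add (hxx j j)
    rw [integral_add h3 ((hxx i j).const_mul 2),
      integral_add (hxx i i) (hxx j j), integral_const_mul, hii, hii] at this
    simp [hij]
    linarith

lemma IsIsotropic.integral_coord {n : ℕ} {K : Set (EuclideanSpace ℝ (Fin n))} {M : ℝ}
    (hK : IsCompact K) (h : IsIsotropic K M) (i : Fin n) : ∫ x in K, x i = 0 := by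
  have hid : IntegrableOn (fun x : EuclideanSpace ℝ (Fin n) => x) K :=
    ContinuousOn.integrableOn_compact hK (by fun_prop)
  have := (EuclideanSpace.proj (𝕜 := ℝ) i).integral_comp_comm hid
  rw [h.2.1, map_zero] at this
  exact this

lemma IsIsotropic.Mpow2n_eq {n : ℕ} {K : Set (EuclideanSpace ℝ (Fin n))} {M : ℝ}
    (hK : IsCompact K) (hv : 0 < (volume K).toReal) (h : IsIsotropic K M) :
    Mpow2n K = (M ^ 2) ^ n := by
  rw [Mpow2n_eq_det hK hv]
  have : (Matrix.of fun i j : Fin n => (∫ x in K, x i * x j) -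
      (∫ x in K, x i) * (∫ x in K, x j) / (volume K).toReal) =
      M ^ 2 • (1 : Matrix (Fin n) (Fin n) ℝ) := by
    ext i j
    simp [h.integral_mul hK, h.integral_coord hK]
  rw [this, Matrix.det_smul]
  simp

lemma setIntegral_eq_add_diff_sub_diff {α : Type*} [MeasurableSpace α] {μ : Measure α}
    {s t : Set α} (hs : MeasurableSet s) (ht : MeasurableSet t) {f : α → ℝ}
    (hfs : IntegrableOn f s μ) (hft : IntegrableOn f t μ) :
    ∫ x in t, f x ∂μ = ∫ x in s, f x ∂μ + ∫ x in t \ s, f x ∂μ - ∫ x in s \ t, f x ∂μ := by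
  have h1 := integral_inter_add_sdiff hs hft
  have h2 := integral_inter_add_sdiff ht hfs
  rw [inter_comm] at h2
  linarith

lemma det_second_moment_gt {n : ℕ} {M v R : ℝ} (hM : 0 < M) (hv : 0 < v) (hR : 1 ≤ R) :
    ∃ C > (0 : ℝ), ∃ r > (0 : ℝ), ∀ (V d η : ℝ) (D : Fin n → Fin n → ℝ) (e : Fin n → ℝ),
      0 < V → V < r → C * V < η → |d| ≤ V → (∀ i j, |D i j| ≤ R ^ 2 * V) →
      (∀ i, |e i| ≤ R * V) → (n + 2) * M ^ 2 / v * d + η * V ≤ ∑ i, D i i →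
      (M ^ 2) ^ n * (v + d) ^ (n + 2) < (Matrix.of fun i j : Fin n =>
        M ^ 2 * (1 : Matrix (Fin n) (Fin n) ℝ) i j + D i j - e i * e j / (v + d)).det
          * v ^ (n + 2) := by
  obtain ⟨C₁, hC₁, r₁, hr₁, h₁⟩ := Matrix.abs_det_one_add_sub_le n
  obtain ⟨C₂, hC₂, r₂, hr₂, h₂⟩ := Matrix.abs_det_one_add_sub_le (n + 2)
  set a := 2 * R ^ 2 / M ^ 2 with ha
  have ha0 : 0 < a := by positivity
  set B := C₁ * a ^ 2 + C₂ / v ^ 2 + n * (2 * R ^ 2 / v / M ^ 2) with hB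
  have hB0 : 0 < B := by positivity
  refine ⟨M ^ 2 * B, by positivity, min (v / 2) (min (r₁ / a) (r₂ * v)), by positivity, ?_⟩
  intro V d η D e hV hVr hη hd hD he htr
  have hV1 : V < v / 2 := hVr.trans_le (min_le_left _ _)
  have hV2 : a * V < r₁ := by
    have := hVr.trans_le ((min_le_right _ _).trans (min_le_left _ _))
    rwa [lt_div_iff₀ ha0, mul_comm] at this
  have hV3 : V / v < r₂ := by
    have := hVr.trans_le ((min_le_right _ _).trans (min_le_right _ _))
    rwa [div_lt_iff₀ hv]
  have hvd : v / 2 ≤ v + d := by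
    have := neg_le_of_abs_le hd
    linarith
  have hvd0 : 0 < v + d := by linarith
  have hinv : (v + d)⁻¹ ≤ 2 / v := by
    rw [inv_le_comm₀ hvd0 (by positivity), inv_div]; exact hvd
  have hee : ∀ i j, |e i * e j / (v + d)| ≤ R ^ 2 * V ^ 2 * (2 / v) := by
    intro i j
    rw [div_eq_mul_inv, abs_mul, abs_mul, abs_of_pos (inv_pos.2 hvd0)]
    have : |e i| * |e j| ≤ (R * V) * (R * V) := by
      gcongr
      · exact he i
      · exact he j
    calc _ ≤ (R * V) * (R * V) * (2 / v) := by gcongr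
      _ = _ := by ring
  set E : Matrix (Fin n) (Fin n) ℝ :=
    Matrix.of fun i j => (D i j - e i * e j / (v + d)) / M ^ 2 with hE
  have hEV : ∀ i j, |E i j| ≤ a * V := by
    intro i j
    simp only [hE, Matrix.of_apply, abs_div, abs_of_pos (pow_pos hM 2)]
    rw [div_le_iff₀ (by positivity)]
    have h3 : R ^ 2 * V ^ 2 * (2 / v) ≤ R ^ 2 * V := by
      have : V * (2 / v) ≤ 1 := by
        rw [mul_div_assoc', div_le_one hv]; linarith
      calc _ = R ^ 2 * V * (V * (2 / v)) := by ring
        _ ≤ R ^ 2 * V * 1 := by gcongr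
        _ = _ := by ring
    have h4 := abs_sub (D i j) (e i * e j / (v + d))
    have h5 : a * V * M ^ 2 = 2 * R ^ 2 * V := by rw [ha]; field_simp
    rw [h5]
    linarith [hD i j, hee i j]
  have hdet := h₁ E (a * V) (by positivity) hV2 hEV
  have hdet2 := h₂ ((d / v) • 1) (V / v) (by positivity) hV3 (by
    intro i j
    rw [Matrix.smul_apply, smul_eq_mul, abs_mul, abs_div, abs_of_pos hv]
    have : |(1 : Matrix (Fin (n + 2)) (Fin (n + 2)) ℝ) i j| ≤ 1 := by
      rw [Matrix.one_apply]; split_ifs <;> simp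
    calc _ ≤ V / v * 1 := by gcongr
      _ = _ := mul_one _)
  have e1 : (1 + (d / v) • (1 : Matrix (Fin (n + 2)) (Fin (n + 2)) ℝ)) = (1 + d / v) • 1 := by
    rw [add_smul, one_smul]
  rw [e1, Matrix.det_smul, Matrix.trace_smul, Matrix.trace_one, Matrix.det_one] at hdet2
  simp only [Fintype.card_fin, mul_one, smul_eq_mul] at hdet2
  push_cast at hdet2
  have htrE : ((n + 2) * M ^ 2 / v * d + η * V) / M ^ 2 - n * (2 * R ^ 2 / v / M ^ 2) * V ^ 2
      ≤ E.trace := by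
    have : E.trace = (∑ i, D i i) / M ^ 2 - (∑ i, e i * e i / (v + d)) / M ^ 2 := by
      rw [Matrix.trace, ← sub_div, ← Finset.sum_sub_distrib, Finset.sum_div]
      rfl
    rw [this]
    have h6 : ∑ i, e i * e i / (v + d) ≤ n * (R ^ 2 * V ^ 2 * (2 / v)) := by
      calc _ ≤ ∑ i : Fin n, R ^ 2 * V ^ 2 * (2 / v) :=
            Finset.sum_le_sum fun i _ => (le_abs_self _).trans (hee i i)
        _ = _ := by simp
    have h7 : (∑ i, e i * e i / (v + d)) / M ^ 2 ≤ n * (2 * R ^ 2 / v / M ^ 2) * V ^ 2 := by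
      rw [div_le_iff₀ (by positivity)]
      refine h6.trans (le_of_eq ?_)
      field_simp
    have h8 : ((n + 2) * M ^ 2 / v * d + η * V) / M ^ 2 ≤ (∑ i, D i i) / M ^ 2 := by gcongr
    linarith
  have hmain : (1 + d / v) ^ (n + 2) < (1 + E).det := by
    have h9 := (abs_le.1 hdet).1
    have h10 := (abs_le.1 hdet2).2
    have h11 : ((n + 2) * M ^ 2 / v * d + η * V) / M ^ 2 = d / v * (n + 2) + η / M ^ 2 * V := by
      field_simp
    have h12 : B * V < η / M ^ 2 := by
      rw [lt_div_iff₀ (by positivity)]; linarith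
    have h13 : B * V * V < η / M ^ 2 * V := by gcongr
    have h14 : B * V * V = C₁ * (a * V) ^ 2 + C₂ * (V / v) ^ 2 +
        n * (2 * R ^ 2 / v / M ^ 2) * V ^ 2 := by rw [hB]; ring
    linarith
  have hmat : (Matrix.of fun i j : Fin n =>
        M ^ 2 * (1 : Matrix (Fin n) (Fin n) ℝ) i j + D i j - e i * e j / (v + d)) =
      M ^ 2 • (1 + E) := by
    ext i j
    simp only [hE, Matrix.of_apply, Matrix.smul_apply, Matrix.add_apply, smul_eq_mul]
    field_simp
    ring
  rw [hmat, Matrix.det_smul, Fintype.card_fin, mul_assoc]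
  have h15 : (v + d) ^ (n + 2) = (1 + d / v) ^ (n + 2) * v ^ (n + 2) := by
    rw [← mul_pow]; congr 1; field_simp
  rw [h15]
  gcongr

lemma abs_setIntegral_sub_setIntegral_le {α : Type*} [MeasurableSpace α] {μ : Measure α}
    {s t : Set α} {f : α → ℝ} {B : ℝ} (hs : μ s < ⊤) (ht : μ t < ⊤)
    (hfs : ∀ x ∈ s, |f x| ≤ B) (hft : ∀ x ∈ t, |f x| ≤ B) :
    |∫ x in s, f x ∂μ - ∫ x in t, f x ∂μ| ≤ B * (μ.real s + μ.real t) := by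
  have h1 := norm_setIntegral_le_of_norm_le_const hs (f := f) (C := B) hfs
  have h2 := norm_setIntegral_le_of_norm_le_const ht (f := f) (C := B) hft
  rw [Real.norm_eq_abs] at h1 h2
  have := abs_sub (∫ x in s, f x ∂μ) (∫ x in t, f x ∂μ)
  linarith

lemma IsIsotropic.isoL_lt_isoL {n : ℕ} (hn : n ≠ 0) {K : Set (EuclideanSpace ℝ (Fin n))} {M : ℝ}
    (hK : IsCompact K) (hv : 0 < (volume K).toReal) (h : IsIsotropic K M) {R : ℝ} (hR : 1 ≤ R)
    (hKR : K ⊆ closedBall 0 R) :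
    ∃ C > (0 : ℝ), ∃ r > (0 : ℝ), ∀ (K' : Set (EuclideanSpace ℝ (Fin n))) (η : ℝ),
      IsCompact K' → 0 < (volume K').toReal → K' ⊆ closedBall 0 R →
      0 < volume.real (K' \ K) + volume.real (K \ K') →
      volume.real (K' \ K) + volume.real (K \ K') < r →
      C * (volume.real (K' \ K) + volume.real (K \ K')) < η →
      (∀ x ∈ K' \ K, (n + 2) * M ^ 2 / (volume K).toReal + η ≤ ‖x‖ ^ 2) →
      (∀ x ∈ K \ K', ‖x‖ ^ 2 ≤ (n + 2) * M ^ 2 / (volume K).toReal - η) →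
      isoL n K < isoL n K' := by
  obtain ⟨C, hC, r, hr, H⟩ := det_second_moment_gt (n := n) h.1 hv hR
  refine ⟨C, hC, r, hr, fun K' η hK' hv' hK'R hV0 hVr hVη hout hin => ?_⟩
  set V := volume.real (K' \ K) + volume.real (K \ K') with hV
  set c := (n + 2) * M ^ 2 / (volume K).toReal with hc
  have f1 : volume (K' \ K) < ⊤ := (measure_mono sdiff_subset).trans_lt hK'.measure_lt_top
  have f2 : volume (K \ K') < ⊤ := (measure_mono sdiff_subset).trans_lt hK.measure_lt_top
  have b1 : ∀ x ∈ K' \ K, ‖x‖ ≤ R := fun x hx => by simpa using hK'R hx.1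
  have b2 : ∀ x ∈ K \ K', ‖x‖ ≤ R := fun x hx => by simpa using hKR hx.1
  have cb : ∀ (x : EuclideanSpace ℝ (Fin n)) i, ‖x‖ ≤ R → |x i| ≤ R := fun x i hx =>
    (PiLp.norm_apply_le x i).trans hx
  have cbb : ∀ (x : EuclideanSpace ℝ (Fin n)) i j, ‖x‖ ≤ R → |x i * x j| ≤ R ^ 2 := by
    intro x i j hx
    rw [abs_mul, sq]
    exact mul_le_mul (cb x i hx) (cb x j hx) (abs_nonneg _) (by linarith)
  have hsplit : ∀ f : EuclideanSpace ℝ (Fin n) → ℝ, Continuous f →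
      ∫ x in K', f x = (∫ x in K, f x) + (∫ x in K' \ K, f x) - ∫ x in K \ K', f x := fun f hf =>
    setIntegral_eq_add_diff_sub_diff hK.measurableSet hK'.measurableSet
      (hf.continuousOn.integrableOn_compact hK) (hf.continuousOn.integrableOn_compact hK')
  set d := volume.real (K' \ K) - volume.real (K \ K') with hd
  have hvd : (volume K').toReal = (volume K).toReal + d := by
    have := hsplit (fun _ => 1) continuous_const
    simp only [setIntegral_const, smul_eq_mul, mul_one] at this
    simp only [Measure.real] at this hd
    rw [this, hd]; ring
  set D : Fin n → Fin n → ℝ := fun i j =>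
    (∫ x in K' \ K, x i * x j) - ∫ x in K \ K', x i * x j with hD
  set e : Fin n → ℝ := fun i => (∫ x in K' \ K, x i) - ∫ x in K \ K', x i with he
  have hmain := H V d η D e hV0 hVr hVη
    (by
      rw [hd, hV, abs_le]
      have p1 : 0 ≤ volume.real (K' \ K) := measureReal_nonneg
      have p2 : 0 ≤ volume.real (K \ K') := measureReal_nonneg
      constructor <;> linarith)
    (fun i j => abs_setIntegral_sub_setIntegral_le f1 f2 (fun x hx => cbb x i j (b1 x hx))
      fun x hx => cbb x i j (b2 x hx))
    (fun i => abs_setIntegral_sub_setIntegral_le f1 f2 (fun x hx => cb x i (b1 x hx))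
      fun x hx => cb x i (b2 x hx))
    (by
      have hi1 : ∀ f : EuclideanSpace ℝ (Fin n) → ℝ, Continuous f → IntegrableOn f (K' \ K) :=
        fun f hf => (hf.continuousOn.integrableOn_compact hK').mono_set sdiff_subset
      have hi2 : ∀ f : EuclideanSpace ℝ (Fin n) → ℝ, Continuous f → IntegrableOn f (K \ K') :=
        fun f hf => (hf.continuousOn.integrableOn_compact hK).mono_set sdiff_subset
      have hnorm : ∀ x : EuclideanSpace ℝ (Fin n), ∑ i, x i * x i = ‖x‖ ^ 2 := by
        intro x
        rw [EuclideanSpace.norm_sq_eq]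
        exact Finset.sum_congr rfl fun i _ => by rw [Real.norm_eq_abs, sq_abs, sq]
      have hsum : ∑ i, D i i = (∫ x in K' \ K, ‖x‖ ^ 2) - ∫ x in K \ K', ‖x‖ ^ 2 := by
        rw [hD, Finset.sum_sub_distrib,
          ← integral_finsetSum _ fun i _ => hi1 (fun x => x i * x i) (by fun_prop),
          ← integral_finsetSum _ fun i _ => hi2 (fun x => x i * x i) (by fun_prop)]
        simp_rw [hnorm]
      have q1 : (c + η) * volume.real (K' \ K) ≤ ∫ x in K' \ K, ‖x‖ ^ 2 :=
        setIntegral_ge_of_const_le_real (hK'.measurableSet.diff hK.measurableSet) f1.ne hout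
          (hi1 _ (by fun_prop))
      have q2 : ∫ x in K \ K', ‖x‖ ^ 2 ≤ (c - η) * volume.real (K \ K') := by
        have := setIntegral_mono_on (hi2 (fun x => ‖x‖ ^ 2) (by fun_prop))
          (hi2 (fun _ => c - η) (by fun_prop)) (hK.measurableSet.diff hK'.measurableSet) hin
        simpa [mul_comm] using this
      rw [hsum, hd, hV]
      linarith)
  refine _root_.isoL_lt_isoL hn ?_ hv hv' ?_
  · rw [h.Mpow2n_eq hK hv]; positivity
  · rw [h.Mpow2n_eq hK hv, Mpow2n_eq_det hK' hv']
    have hm : (Matrix.of fun i j : Fin n => (∫ x in K', x i * x j) -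
        (∫ x in K', x i) * (∫ x in K', x j) / (volume K').toReal) = Matrix.of fun i j : Fin n =>
        M ^ 2 * (1 : Matrix (Fin n) (Fin n) ℝ) i j + D i j
          - e i * e j / ((volume K).toReal + d) := by
      ext i j
      simp only [Matrix.of_apply]
      rw [hsplit (fun x => x i * x j) (by fun_prop), hsplit (fun x => x i) (by fun_prop),
        hsplit (fun x => x j) (by fun_prop), h.integral_mul hK, h.integral_coord hK,
        h.integral_coord hK, hvd]
      simp only [hD, he, zero_add, add_sub_assoc]
    rw [hm, hvd]
    exact hmain

lemma IsConvexBody.toReal_volume_pos {n : ℕ} {K : Set (EuclideanSpace ℝ (Fin n))}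
    (hK : IsConvexBody K) : 0 < (volume K).toReal :=
  ENNReal.toReal_pos (Measure.measure_pos_of_nonempty_interior _ hK.2.2).ne' hK.1.measure_lt_top.ne

/-- A local maximizer admits no small perturbation near a point gaining mass where the norm
exceeds the critical radius by a definite amount and losing mass where it falls short of it. -/
lemma IsLocalMaxIso.no_small_gain {n : ℕ} (hn : 2 ≤ n) {K : Set (EuclideanSpace ℝ (Fin n))}
    {M : ℝ} (hK : IsConvexBody K) (hiso : IsIsotropic K M) (hmax : IsLocalMaxIso K)
    {X₀ : EuclideanSpace ℝ (Fin n)} (hX₀ : X₀ ∈ K) {A κ : ℝ} (hA : 0 < A) (hκ : 0 < κ) :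
    ∃ t₀ > (0 : ℝ), ∀ t, 0 < t → t < t₀ → ∀ K' : Set (EuclideanSpace ℝ (Fin n)),
      IsConvexBody K' → X₀ ∈ K' → K' \ K ⊆ closedBall X₀ (A * t) →
      K \ K' ⊆ closedBall X₀ (A * t) →
      (∀ x ∈ K' \ K, (n + 2) * M ^ 2 / (volume K).toReal + κ * t ≤ ‖x‖ ^ 2) →
      (∀ x ∈ K \ K', ‖x‖ ^ 2 ≤ (n + 2) * M ^ 2 / (volume K).toReal - κ * t) →
      ¬ 0 < volume.real (K' \ K) + volume.real (K \ K') := by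
  obtain ⟨ε, hε, hmax⟩ := hmax
  obtain ⟨R₀, hR₀⟩ := hK.1.isBounded.subset_closedBall 0
  set R := max 1 (R₀ + 1) + ‖X₀‖ with hR
  have hR1 : 1 ≤ R := (le_max_left _ _).trans (le_add_of_nonneg_right (norm_nonneg _))
  have hR2 : R₀ + 1 ≤ R := (le_max_right _ _).trans (le_add_of_nonneg_right (norm_nonneg _))
  have hR3 : ‖X₀‖ + 1 ≤ R := by linarith [le_max_left 1 (R₀ + 1)]
  have hKR : K ⊆ closedBall 0 R := hR₀.trans (closedBall_subset_closedBall (by linarith))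
  obtain ⟨C, hC, r, hr, H⟩ := hiso.isoL_lt_isoL (by omega : n ≠ 0) hK.1 hK.toReal_volume_pos hR1 hKR
  set β := volume.real (ball (0 : EuclideanSpace ℝ (Fin n)) 1) with hβ
  have hβ0 : 0 ≤ β := measureReal_nonneg
  set B := 2 * (A ^ n * β) + 1 with hB
  have hB0 : 0 < B := by positivity
  refine ⟨min (min 1 (1 / A)) (min (ε / A) (min (r / B) (κ / (C * B)))), by positivity, ?_⟩
  intro t ht htt K' hK' hX₀' hs1 hs2 hout hin hpos
  simp only [lt_min_iff] at htt
  obtain ⟨⟨t1, t2⟩, t3, t4, t5⟩ := htt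
  rw [lt_div_iff₀ hA] at t2 t3
  rw [lt_div_iff₀ hB0] at t4
  rw [lt_div_iff₀ (by positivity)] at t5
  have hhd : hausdorffDist K' K < ε := by
    refine (hausdorffDist_le_of_mem_dist (r := A * t) (by positivity) ?_ ?_).trans_lt (by linarith)
    · intro x hx
      by_cases hxK : x ∈ K
      · exact ⟨x, hxK, by simp; positivity⟩
      · exact ⟨X₀, hX₀, hs1 ⟨hx, hxK⟩⟩
    · intro x hx
      by_cases hxK : x ∈ K'
      · exact ⟨x, hxK, by simp; positivity⟩
      · exact ⟨X₀, hX₀', hs2 ⟨hx, hxK⟩⟩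
  have hball : volume.real (closedBall X₀ (A * t)) ≤ A ^ n * β * t ^ 2 := by
    rw [Measure.real, Measure.addHaar_closedBall _ _ (by positivity), ENNReal.toReal_mul,
      ENNReal.toReal_ofReal (by positivity), finrank_euclideanSpace_fin, mul_pow]
    have : t ^ n ≤ t ^ 2 := pow_le_pow_of_le_one ht.le t1.le hn
    calc _ = A ^ n * β * t ^ n := by rw [hβ, Measure.real]; ring
      _ ≤ _ := by gcongr
  have hfin : volume (closedBall X₀ (A * t)) ≠ ⊤ := (isCompact_closedBall _ _).measure_lt_top.ne
  have hV : volume.real (K' \ K) + volume.real (K \ K') ≤ B * t ^ 2 := by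
    have := measureReal_mono hs1 hfin
    have := measureReal_mono hs2 hfin
    nlinarith [sq_nonneg t]
  have hK'R : K' ⊆ closedBall 0 R := by
    intro x hx
    by_cases hxK : x ∈ K
    · exact hKR hxK
    · have h1 := hs1 ⟨hx, hxK⟩
      rw [mem_closedBall, dist_eq_norm] at h1
      rw [mem_closedBall_zero_iff]
      have := norm_add_le (x - X₀) X₀
      rw [sub_add_cancel] at this
      linarith
  have hsq : B * t ^ 2 ≤ B * t := by
    have : t ^ 2 ≤ t := by nlinarith
    gcongr
  refine absurd (hmax K' hK' hhd) (not_le.2 ?_)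
  refine H K' (κ * t) hK'.1 hK'.toReal_volume_pos hK'R hpos (by linarith) ?_ hout hin
  calc _ ≤ C * (B * t ^ 2) := by gcongr
    _ = t * (C * B) * t := by ring
    _ < κ * t := by gcongr

lemma CurvWitness.exists_posDef {n : ℕ} {K : Set (EuclideanSpace ℝ (Fin n))}
    {X₀ N : EuclideanSpace ℝ (Fin n)} {q : QuadraticForm ℝ (EuclideanSpace ℝ (Fin n))}
    (h : CurvWitness K X₀ N q) :
    ∃ Q : QuadraticForm ℝ (EuclideanSpace ℝ (Fin n)), CurvWitness K X₀ N Q ∧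
      (∀ x, x ≠ 0 → 0 < Q x) ∧ ∀ Y, ⟪Y, N⟫_ℝ = 0 → QuadraticMap.polar Q Y N = 0 := by
  obtain ⟨hN, hsupp, hq, hcurv⟩ := h
  have hNN : ⟪N, N⟫_ℝ = 1 := by rw [real_inner_self_eq_norm_sq, hN]; norm_num
  set ℓ : EuclideanSpace ℝ (Fin n) →ₗ[ℝ] ℝ := (innerSL ℝ N).toLinearMap with hℓ
  have hℓ' : ∀ x, ℓ x = ⟪x, N⟫_ℝ := fun x => by
    simp [hℓ, real_inner_comm]
  set P : EuclideanSpace ℝ (Fin n) →ₗ[ℝ] EuclideanSpace ℝ (Fin n) :=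
    LinearMap.id - ℓ.smulRight N with hP
  have hP' : ∀ x, P x = x - ⟪x, N⟫_ℝ • N := fun x => by simp [hP, hℓ']
  set Q : QuadraticForm ℝ (EuclideanSpace ℝ (Fin n)) :=
    q.comp P + (QuadraticMap.sq (R := ℝ)).comp ℓ with hQ
  have hQ' : ∀ x, Q x = q (x - ⟪x, N⟫_ℝ • N) + ⟪x, N⟫_ℝ * ⟪x, N⟫_ℝ := fun x => by
    simp [hQ, hP', hℓ']
  have hQq : ∀ Y, ⟪Y, N⟫_ℝ = 0 → Q Y = q Y := fun Y hY => by simp [hQ', hY]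
  refine ⟨Q, ⟨hN, hsupp, fun Y hY hY0 => by rw [hQq Y hY]; exact hq Y hY hY0, ?_⟩, ?_, ?_⟩
  · intro ε hε
    obtain ⟨a, ha, H⟩ := hcurv ε hε
    exact ⟨a, ha, fun Y y hY hm => by rw [hQq Y hY]; exact H Y y hY hm⟩
  · intro x hx
    rw [hQ']
    have ho : ⟪x - ⟪x, N⟫_ℝ • N, N⟫_ℝ = 0 := by
      rw [inner_sub_left, real_inner_smul_left, hNN, mul_one, sub_self]
    by_cases hx0 : x - ⟪x, N⟫_ℝ • N = 0
    · rw [hx0, QuadraticMap.map_zero, zero_add]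
      have : ⟪x, N⟫_ℝ ≠ 0 := by
        intro hc
        rw [hc, zero_smul, sub_zero] at hx0
        exact hx hx0
      exact mul_self_pos.2 this
    · have := hq _ ho hx0
      nlinarith [mul_self_nonneg ⟪x, N⟫_ℝ]
  · intro Y hY
    rw [QuadraticMap.polar, hQ', hQ', hQ']
    simp [inner_add_left, hY, hN]

lemma QuadraticForm.exists_bounds_of_pos {n : ℕ}
    {q : QuadraticForm ℝ (EuclideanSpace ℝ (Fin n))} (hq : ∀ x, x ≠ 0 → 0 < q x) :
    ∃ l > (0 : ℝ), ∃ m > (0 : ℝ), ∀ x, l * ‖x‖ ^ 2 ≤ q x ∧ q x ≤ m * ‖x‖ ^ 2 := by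
  have hcont : Continuous q := by
    have h : ∀ x, q x = (1 / 2) * q.polarBilin.toContinuousBilinearMap x x := by
      intro x
      rw [LinearMap.toContinuousBilinearMap_apply, QuadraticMap.polarBilin_apply_apply,
        QuadraticMap.polar_self]
      simp
    have : (q : EuclideanSpace ℝ (Fin n) → ℝ) =
      fun x => (1 / 2) * q.polarBilin.toContinuousBilinearMap x x := funext h
    rw [this]
    fun_prop
  have hhom : ∀ x : EuclideanSpace ℝ (Fin n), x ≠ 0 → q x = ‖x‖ ^ 2 * q (‖x‖⁻¹ • x) := by
    intro x hx
    have : ‖x‖ ≠ 0 := norm_ne_zero_iff.2 hx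
    rw [QuadraticMap.map_smul, smul_eq_mul]
    field_simp
  have hsph : ∀ x : EuclideanSpace ℝ (Fin n), x ≠ 0 → ‖x‖⁻¹ • x ∈
      sphere (0 : EuclideanSpace ℝ (Fin n)) 1 := by
    intro x hx
    simp [norm_smul, inv_mul_cancel₀ (norm_ne_zero_iff.2 hx)]
  rcases (sphere (0 : EuclideanSpace ℝ (Fin n)) 1).eq_empty_or_nonempty with he | hne
  · refine ⟨1, one_pos, 1, one_pos, fun x => ?_⟩
    have : x = 0 := by
      by_contra hx
      simpa [he] using hsph x hx
    simp [this]
  · obtain ⟨u, hu, hmin⟩ := (isCompact_sphere _ _).exists_isMinOn hne hcont.continuousOn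
    obtain ⟨w, hw, hmax⟩ := (isCompact_sphere _ _).exists_isMaxOn hne hcont.continuousOn
    have h0 : ∀ x ∈ sphere (0 : EuclideanSpace ℝ (Fin n)) 1, 0 < q x := fun x hx =>
      hq x (ne_zero_of_mem_unit_sphere ⟨x, hx⟩)
    refine ⟨q u, h0 u hu, q w, h0 w hw, fun x => ?_⟩
    rcases eq_or_ne x 0 with rfl | hx
    · simp
    · rw [hhom x hx, mul_comm (q u), mul_comm (q w)]
      exact ⟨by gcongr; exact hmin (hsph x hx), by gcongr; exact hmax (hsph x hx)⟩

lemma exists_first_entry {n : ℕ} {K : Set (EuclideanSpace ℝ (Fin n))} (hK : IsClosed K)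
    {x z : EuclideanSpace ℝ (Fin n)} (hx : x ∉ K) (hz : z ∈ K) :
    ∃ s : ℝ, 0 < s ∧ s ≤ 1 ∧ x + s • (z - x) ∈ K ∧ x + s • (z - x) ∈ frontier K ∧
      ∀ r : ℝ, 0 ≤ r → r < s → x + r • (z - x) ∉ K := by
  set f : ℝ → EuclideanSpace ℝ (Fin n) := fun s => x + s • (z - x) with hf
  have hfc : Continuous f := by fun_prop
  have hS : IsCompact (Icc (0 : ℝ) 1 ∩ f ⁻¹' K) := isCompact_Icc.inter_right (hK.preimage hfc)
  have hne : (Icc (0 : ℝ) 1 ∩ f ⁻¹' K).Nonempty := ⟨1, by simp, by simpa [hf] using hz⟩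
  obtain ⟨s, ⟨hs, hsK⟩, hleast⟩ := hS.exists_isLeast hne
  have hs0 : 0 < s := by
    rcases hs.1.eq_or_lt with h | h
    · rw [← h] at hsK; exact absurd (by simpa [hf] using hsK) hx
    · exact h
  have hout : ∀ r, 0 ≤ r → r < s → f r ∉ K := fun r hr hrs hrK =>
    absurd (hleast ⟨⟨hr, hrs.le.trans hs.2⟩, hrK⟩) (not_le.2 hrs)
  refine ⟨s, hs0, hs.2, hsK, ⟨subset_closure hsK, fun hint => ?_⟩, hout⟩
  have hopen : IsOpen (f ⁻¹' interior K) := isOpen_interior.preimage hfc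
  obtain ⟨δ, hδ, hball⟩ := Metric.isOpen_iff.1 hopen s hint
  have hm : s - min (δ / 2) s ∈ ball s δ := by
    rw [mem_ball, Real.dist_eq, sub_sub_cancel_left, abs_neg, abs_of_pos (by positivity)]
    exact (min_le_left _ _).trans_lt (by linarith)
  exact hout _ (by linarith [min_le_right (δ / 2) s])
    (by linarith [lt_min (half_pos hδ) hs0]) (interior_subset (hball hm))

lemma norm_add_smul_le {n : ℕ} {N Y : EuclideanSpace ℝ (Fin n)} (hN : ‖N‖ = 1) (y : ℝ) :
    ‖Y + y • N‖ ≤ ‖Y‖ + |y| := by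
  have := norm_add_le Y (y • N)
  rwa [norm_smul, hN, mul_one, Real.norm_eq_abs] at this

lemma CurvWitness.inner_pos_of_mem_interior {n : ℕ} {K : Set (EuclideanSpace ℝ (Fin n))}
    {X₀ N : EuclideanSpace ℝ (Fin n)} {q : QuadraticForm ℝ (EuclideanSpace ℝ (Fin n))}
    (h : CurvWitness K X₀ N q) {k : EuclideanSpace ℝ (Fin n)} (hk : k ∈ interior K) :
    0 < ⟪k - X₀, N⟫_ℝ := by
  obtain ⟨hN, hsupp, -, -⟩ := h
  obtain ⟨δ, hδ, hball⟩ := Metric.isOpen_iff.1 isOpen_interior k hk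
  have hm : k - (δ / 2) • N ∈ K := interior_subset (hball (by
    rw [mem_ball, dist_eq_norm, sub_sub_cancel_left, norm_neg, norm_smul, hN, Real.norm_eq_abs,
      abs_of_pos (by positivity)]
    linarith))
  have := hsupp _ hm
  have e : k - (δ / 2) • N - X₀ = (k - X₀) - (δ / 2) • N := by abel
  rw [e, inner_sub_left, real_inner_smul_left, real_inner_self_eq_norm_sq, hN] at this
  linarith

lemma CurvWitness.exists_normal_mem_interior {n : ℕ} {K : Set (EuclideanSpace ℝ (Fin n))}
    (hK : IsConvexBody K) {X₀ N : EuclideanSpace ℝ (Fin n)} (hX₀ : X₀ ∈ K)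
    {q : QuadraticForm ℝ (EuclideanSpace ℝ (Fin n))} (hq : ∀ x, x ≠ 0 → 0 < q x)
    (h : CurvWitness K X₀ N q) {δ : ℝ} (hδ : 0 < δ) :
    ∃ t : ℝ, 0 < t ∧ t < δ ∧ X₀ + t • N ∈ interior K := by
  obtain ⟨k, hk⟩ := hK.2.2
  have hz := h.inner_pos_of_mem_interior hk
  obtain ⟨hN, hsupp, -, hcurv⟩ := h
  obtain ⟨a, ha, H⟩ := hcurv 1 one_pos
  set z := ⟪k - X₀, N⟫_ℝ with hzd
  set Z := (k - X₀) - z • N with hZ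
  have hZN : ⟪Z, N⟫_ℝ = 0 := by
    rw [hZ, inner_sub_left, real_inner_smul_left, real_inner_self_eq_norm_sq, hN, ← hzd]; ring
  have hkX : k - X₀ = Z + z • N := by rw [hZ]; abel
  have hqZ : 0 ≤ q Z := by
    rcases eq_or_ne Z 0 with h0 | h0
    · simp [h0]
    · exact (hq Z h0).le
  set s := min (min (1 / 2) (δ / (2 * z)))
    (min (a / (2 * (‖Z‖ + z))) (z / (2 * (2 * q Z + 1)))) with hs
  have hs0 : 0 < s := by positivity
  have hs1 : s ≤ 1 / 2 := (min_le_left _ _).trans (min_le_left _ _)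
  have hs2 : s * (2 * z) ≤ δ := by
    rw [← le_div_iff₀ (by positivity)]
    exact (min_le_left _ _).trans (min_le_right _ _)
  have hs3 : s * (2 * (‖Z‖ + z)) ≤ a := by
    rw [← le_div_iff₀ (by positivity)]
    exact (min_le_right _ _).trans (min_le_left _ _)
  have hs4 : s * (2 * (2 * q Z + 1)) ≤ z := by
    rw [← le_div_iff₀ (by positivity)]
    exact (min_le_right _ _).trans (min_le_right _ _)
  refine ⟨s * z, by positivity, by nlinarith, ?_⟩
  by_contra hni
  have htop : X₀ + s • (k - X₀) ∈ interior K :=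
    hK.2.1.add_smul_sub_mem_interior hX₀ hk ⟨hs0, by linarith⟩
  have hfr : ∃ r : ℝ, 0 ≤ r ∧ r ≤ 1 ∧ X₀ + (r * s) • Z + (s * z) • N ∈ frontier K := by
    by_cases hin : X₀ + (s * z) • N ∈ K
    · exact ⟨0, le_rfl, zero_le_one, by simpa using ⟨subset_closure hin, hni⟩⟩
    · obtain ⟨r, hr0, hr1, -, hr, -⟩ := exists_first_entry hK.1.isClosed hin (interior_subset htop)
      refine ⟨r, hr0.le, hr1, ?_⟩
      convert hr using 1
      rw [hkX]
      module
  obtain ⟨r, hr0, hr1, hr⟩ := hfr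
  have hrs : r * s ≤ s := by nlinarith
  have hmem : X₀ + (r * s) • Z + (s * z) • N ∈ ball X₀ a := by
    rw [mem_ball, dist_eq_norm, show X₀ + (r * s) • Z + (s * z) • N - X₀ =
      (r * s) • Z + (s * z) • N by abel]
    refine (norm_add_smul_le hN _).trans_lt ?_
    rw [norm_smul, Real.norm_eq_abs, abs_of_nonneg (by positivity), abs_of_pos (by positivity)]
    have : r * s * ‖Z‖ ≤ s * ‖Z‖ := by gcongr
    nlinarith [norm_nonneg Z]
  have := (H ((r * s) • Z) (s * z) (by rw [real_inner_smul_left, hZN, mul_zero]) ⟨hr, hmem⟩).2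
  rw [QuadraticMap.map_smul, smul_eq_mul] at this
  have h1 : (r * s) * (r * s) * q Z ≤ s * s * q Z := by gcongr
  nlinarith

/-- Near `X₀` the body `K` lies between two paraboloids of axis `N`, and the homothety of
centre `X₀` and ratio `θ` brings `K` into the neighbourhood of size `a` where this holds. -/
structure ParaboloidBounds {n : ℕ} (K : Set (EuclideanSpace ℝ (Fin n)))
    (X₀ N : EuclideanSpace ℝ (Fin n)) (q : QuadraticForm ℝ (EuclideanSpace ℝ (Fin n)))
    (a θ : ℝ) : Prop where
  norm_eq : ‖N‖ = 1
  mem : X₀ ∈ K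
  pos : ∀ x, x ≠ 0 → 0 < q x
  a_pos : 0 < a
  θ_pos : 0 < θ
  θ_le : θ ≤ 1
  support : ∀ x ∈ K, 0 ≤ ⟪x - X₀, N⟫_ℝ
  upper : ∀ (Y : EuclideanSpace ℝ (Fin n)) (y : ℝ), ⟪Y, N⟫_ℝ = 0 → ‖Y‖ < a → |y| < a →
    9 / 8 * q Y < y → X₀ + Y + y • N ∈ K
  lower : ∀ (Y : EuclideanSpace ℝ (Fin n)) (y : ℝ), ⟪Y, N⟫_ℝ = 0 → ‖Y‖ < a → |y| < a →
    X₀ + Y + y • N ∈ K → 7 / 8 * q Y ≤ y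
  shrink : ∀ (Y : EuclideanSpace ℝ (Fin n)) (y : ℝ), ⟪Y, N⟫_ℝ = 0 →
    X₀ + Y + y • N ∈ K → θ * ‖Y‖ < a ∧ θ * |y| < a

lemma inner_add_add_smul_sub {n : ℕ} {X₀ N Y : EuclideanSpace ℝ (Fin n)} (hN : ‖N‖ = 1)
    (hY : ⟪Y, N⟫_ℝ = 0) (y : ℝ) : ⟪X₀ + Y + y • N - X₀, N⟫_ℝ = y := by
  rw [show X₀ + Y + y • N - X₀ = Y + y • N by abel, inner_add_left, hY, real_inner_smul_left,
    real_inner_self_eq_norm_sq, hN]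
  ring

lemma exists_eq_add_add_smul {n : ℕ} (X₀ : EuclideanSpace ℝ (Fin n))
    {N : EuclideanSpace ℝ (Fin n)} (hN : ‖N‖ = 1) (x : EuclideanSpace ℝ (Fin n)) :
    ∃ Y : EuclideanSpace ℝ (Fin n), ∃ y : ℝ, ⟪Y, N⟫_ℝ = 0 ∧ x = X₀ + Y + y • N := by
  refine ⟨(x - X₀) - ⟪x - X₀, N⟫_ℝ • N, ⟪x - X₀, N⟫_ℝ, ?_, by abel⟩
  rw [inner_sub_left, real_inner_smul_left, real_inner_self_eq_norm_sq, hN]; ring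

lemma CurvWitness.exists_paraboloidBounds {n : ℕ} {K : Set (EuclideanSpace ℝ (Fin n))}
    (hK : IsConvexBody K) {X₀ N : EuclideanSpace ℝ (Fin n)} (hX₀ : X₀ ∈ K)
    {q : QuadraticForm ℝ (EuclideanSpace ℝ (Fin n))} (hq : ∀ x, x ≠ 0 → 0 < q x)
    (h : CurvWitness K X₀ N q) : ∃ a θ, ParaboloidBounds K X₀ N q a θ := by
  have htop := fun δ (hδ : 0 < δ) => h.exists_normal_mem_interior hK hX₀ hq hδ
  obtain ⟨hN, hsupp, -, hcurv⟩ := h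
  obtain ⟨a₀, ha₀, H⟩ := hcurv (1 / 8) (by norm_num)
  have Hb : ∀ (Y : EuclideanSpace ℝ (Fin n)) (y : ℝ), ⟪Y, N⟫_ℝ = 0 → ‖Y‖ < a₀ / 2 →
      |y| ≤ a₀ / 2 → X₀ + Y + y • N ∈ frontier K → 7 / 8 * q Y ≤ y ∧ y ≤ 9 / 8 * q Y := by
    intro Y y hY hYa hya hf
    have hb : X₀ + Y + y • N ∈ ball X₀ a₀ := by
      rw [mem_ball, dist_eq_norm, show X₀ + Y + y • N - X₀ = Y + y • N by abel]
      linarith [norm_add_smul_le hN y (Y := Y)]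
    have := H Y y hY ⟨hf, hb⟩
    constructor <;> linarith [this.1, this.2]
  obtain ⟨h₀, hh0, hha, hint⟩ := htop (a₀ / 2) (by positivity)
  obtain ⟨ρ, hρ, hball⟩ := Metric.isOpen_iff.1 isOpen_interior _ hint
  set a := min (min ρ h₀) (a₀ / 4) with ha
  have ha0 : 0 < a := by positivity
  have ha1 : a ≤ ρ := (min_le_left _ _).trans (min_le_left _ _)
  have ha2 : a ≤ h₀ := (min_le_left _ _).trans (min_le_right _ _)
  have ha3 : a ≤ a₀ / 4 := min_le_right _ _
  obtain ⟨R, hR⟩ := hK.1.isBounded.subset_closedBall X₀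
  have hR0 : 0 ≤ R := by simpa using hR hX₀
  refine ⟨a, min 1 (a / (2 * (R + 1))), hN, hX₀, hq, ha0, by positivity, min_le_left _ _, hsupp,
    ?_, ?_, ?_⟩
  · intro Y y hY hYa hya hlt
    by_contra hout
    have hin : X₀ + Y + h₀ • N ∈ K := by
      refine interior_subset (hball ?_)
      rw [mem_ball, dist_eq_norm, show X₀ + Y + h₀ • N - (X₀ + h₀ • N) = Y by abel]
      linarith
    obtain ⟨s, hs0, hs1, -, hf, -⟩ := exists_first_entry hK.1.isClosed hout hin
    have e : X₀ + Y + y • N + s • (X₀ + Y + h₀ • N - (X₀ + Y + y • N)) =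
        X₀ + Y + (y + s * (h₀ - y)) • N := by module
    rw [e] at hf
    rw [abs_lt] at hya
    have h1 : y ≤ y + s * (h₀ - y) := by nlinarith
    have h2 : y + s * (h₀ - y) ≤ h₀ := by nlinarith
    have := (Hb Y _ hY (by linarith) (abs_le.2 ⟨by linarith, by linarith⟩) hf).2
    linarith
  · intro Y y hY hYa hya hin
    rw [abs_lt] at hya
    have hout : X₀ + Y + (-a) • N ∉ K := by
      intro hc
      have := hsupp _ hc
      rw [inner_add_add_smul_sub hN hY] at this
      linarith
    obtain ⟨s, hs0, hs1, hm, hf, -⟩ := exists_first_entry hK.1.isClosed hout hin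
    have e : X₀ + Y + (-a) • N + s • (X₀ + Y + y • N - (X₀ + Y + (-a) • N)) =
        X₀ + Y + (-a + s * (y + a)) • N := by module
    rw [e] at hf
    have h1 : -a ≤ -a + s * (y + a) := by nlinarith
    have h2 : -a + s * (y + a) ≤ y := by nlinarith
    have := (Hb Y _ hY (by linarith) (abs_le.2 ⟨by linarith, by linarith⟩) hf).1
    linarith
  · intro Y y hY hin
    have hx := hR hin
    rw [mem_closedBall, dist_eq_norm] at hx
    have hy : |y| ≤ R := by
      have := abs_real_inner_le_norm (X₀ + Y + y • N - X₀) N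
      rw [inner_add_add_smul_sub hN hY, hN] at this
      linarith
    have hYR : ‖Y‖ ≤ 2 * R := by
      have h1 : Y = (X₀ + Y + y • N - X₀) + (-y) • N := by module
      have := norm_add_smul_le hN (-y) (Y := X₀ + Y + y • N - X₀)
      rw [← h1, abs_neg] at this
      linarith
    have hθ : min 1 (a / (2 * (R + 1))) * (2 * (R + 1)) ≤ a := by
      rw [← le_div_iff₀ (by positivity)]; exact min_le_right _ _
    have hθ0 : 0 < min 1 (a / (2 * (R + 1))) := by positivity
    constructor <;> nlinarith

namespace ParaboloidBounds

variable {n : ℕ} {K : Set (EuclideanSpace ℝ (Fin n))} {X₀ N : EuclideanSpace ℝ (Fin n)}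
  {q : QuadraticForm ℝ (EuclideanSpace ℝ (Fin n))} {a θ : ℝ}

lemma nonneg (h : ParaboloidBounds K X₀ N q a θ) (x : EuclideanSpace ℝ (Fin n)) : 0 ≤ q x := by
  rcases eq_or_ne x 0 with rfl | hx
  · simp
  · exact (h.pos x hx).le

lemma global_lower (h : ParaboloidBounds K X₀ N q a θ) (hK : Convex ℝ K)
    {Y : EuclideanSpace ℝ (Fin n)} {y : ℝ} (hY : ⟪Y, N⟫_ℝ = 0) (hm : X₀ + Y + y • N ∈ K) :
    7 / 8 * θ * q Y ≤ y := by
  obtain ⟨h1, h2⟩ := h.shrink Y y hY hm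
  have hθ := h.θ_pos
  have hm' : X₀ + θ • Y + (θ * y) • N ∈ K := by
    have := hK.add_smul_sub_mem h.mem hm ⟨hθ.le, h.θ_le⟩
    convert this using 1
    module
  have := h.lower (θ • Y) (θ * y) (by rw [real_inner_smul_left, hY, mul_zero])
    (by rwa [norm_smul, Real.norm_eq_abs, abs_of_pos hθ])
    (by rwa [abs_mul, abs_of_pos hθ]) hm'
  rw [QuadraticMap.map_smul, smul_eq_mul] at this
  nlinarith

lemma height_nonneg (h : ParaboloidBounds K X₀ N q a θ)
    {Y : EuclideanSpace ℝ (Fin n)} {y : ℝ} (hY : ⟪Y, N⟫_ℝ = 0) (hm : X₀ + Y + y • N ∈ K) :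
    0 ≤ y := by
  have := h.support _ hm
  rwa [inner_add_add_smul_sub h.norm_eq hY] at this

/-- The normal of `K` at `X₀` is unique. -/
lemma outer_normal_eq (h : ParaboloidBounds K X₀ N q a θ) {N' : EuclideanSpace ℝ (Fin n)}
    (hN' : ‖N'‖ = 1) (hsupp : ∀ X ∈ K, ⟪X, N'⟫_ℝ ≤ ⟪X₀, N'⟫_ℝ) : N' = -N := by
  have hN := h.norm_eq
  have ha := h.a_pos
  have hNN : ⟪N, N⟫_ℝ = 1 := by rw [real_inner_self_eq_norm_sq, hN]; norm_num
  obtain ⟨S, α, hS, hdec⟩ := exists_eq_add_add_smul 0 hN N'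
  rw [zero_add] at hdec
  have key : ∀ (Y : EuclideanSpace ℝ (Fin n)) (y : ℝ), ⟪Y, N⟫_ℝ = 0 → X₀ + Y + y • N ∈ K →
      ⟪Y, S⟫_ℝ + y * α ≤ 0 := by
    intro Y y hY hm
    have h1 := hsupp _ hm
    have h2 : ⟪X₀ + Y + y • N, N'⟫_ℝ = ⟪X₀, N'⟫_ℝ + (⟪Y, S⟫_ℝ + y * α) := by
      rw [inner_add_left, inner_add_left, add_assoc]
      congr 1
      rw [hdec, inner_add_right, inner_smul_right, hY, inner_add_right, real_inner_smul_left,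
        real_inner_smul_left, inner_smul_right, real_inner_comm S N, hS, hNN]
      ring
    linarith
  have hα : α ≤ 0 := by
    have := key 0 (a / 2) (by simp) (h.upper 0 _ (by simp) (by simpa using ha)
      (by rw [abs_of_pos (by positivity)]; linarith) (by simp; positivity))
    simp only [inner_zero_left, zero_add] at this
    nlinarith
  have hS0 : S = 0 := by
    by_contra hne
    have hqS := h.pos S hne
    have hSn : 0 < ‖S‖ := norm_pos_iff.2 hne
    set t := min (min 1 (a / (2 * ‖S‖))) (min (a / (4 * q S)) (‖S‖ ^ 2 / (4 * q S * (|α| + 1))))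
      with ht
    have ht0 : 0 < t := by positivity
    have ht1 : t ≤ 1 := (min_le_left _ _).trans (min_le_left _ _)
    have ht2 : t * (2 * ‖S‖) ≤ a := by
      rw [← le_div_iff₀ (by positivity)]; exact (min_le_left _ _).trans (min_le_right _ _)
    have ht3 : t * (4 * q S) ≤ a := by
      rw [← le_div_iff₀ (by positivity)]; exact (min_le_right _ _).trans (min_le_left _ _)
    have ht4 : t * (4 * q S * (|α| + 1)) ≤ ‖S‖ ^ 2 := by
      rw [← le_div_iff₀ (by positivity)]; exact (min_le_right _ _).trans (min_le_right _ _)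
    have hm := h.upper (t • S) (2 * (t * t * q S)) (by rw [real_inner_smul_left, hS, mul_zero])
      (by rw [norm_smul, Real.norm_eq_abs, abs_of_pos ht0]; nlinarith)
      (by
        rw [abs_of_pos (by positivity)]
        have : t * (t * q S) ≤ 1 * (t * q S) := by gcongr
        nlinarith)
      (by
        rw [QuadraticMap.map_smul, smul_eq_mul]
        have : 0 < t * t * q S := by positivity
        linarith)
    have := key _ _ (by rw [real_inner_smul_left, hS, mul_zero]) hm
    rw [real_inner_smul_left, real_inner_self_eq_norm_sq] at this
    have h3 : -(|α| + 1) ≤ α := by linarith [neg_abs_le α]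
    have h4 : 2 * (t * t * q S) * (-(|α| + 1)) ≤ 2 * (t * t * q S) * α := by gcongr
    have h5 : t * (t * (4 * q S * (|α| + 1))) ≤ t * ‖S‖ ^ 2 := by gcongr
    have h6 : 0 < t * ‖S‖ ^ 2 := by positivity
    nlinarith
  rw [hS0, zero_add] at hdec
  have : |α| = 1 := by
    rw [hdec, norm_smul, hN, mul_one, Real.norm_eq_abs] at hN'
    exact hN'
  rw [abs_of_nonpos hα] at this
  rw [hdec, show α = -1 by linarith, neg_one_smul]

end ParaboloidBounds

lemma IsConvexBody.interior_inter_nonempty {n : ℕ} {K : Set (EuclideanSpace ℝ (Fin n))}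
    (hK : IsConvexBody K) {O : Set (EuclideanSpace ℝ (Fin n))} (hO : IsOpen O)
    {x : EuclideanSpace ℝ (Fin n)} (hx : x ∈ K) (hxO : x ∈ O) :
    (interior (K ∩ O)).Nonempty := by
  have hcl : x ∈ closure (interior K) := by
    rw [hK.2.1.closure_interior_eq_closure_of_nonempty_interior hK.2.2]
    exact subset_closure hx
  obtain ⟨y, hyO, hyK⟩ := mem_closure_iff.1 hcl O hO hxO
  exact ⟨y, by rw [interior_inter, hO.interior_eq]; exact ⟨hyK, hyO⟩⟩

lemma IsConvexBody.volume_real_inter_pos {n : ℕ} {K : Set (EuclideanSpace ℝ (Fin n))}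
    (hK : IsConvexBody K) {O : Set (EuclideanSpace ℝ (Fin n))} (hO : IsOpen O)
    {x : EuclideanSpace ℝ (Fin n)} (hx : x ∈ K) (hxO : x ∈ O) : 0 < volume.real (K ∩ O) :=
  ENNReal.toReal_pos
    (Measure.measure_pos_of_nonempty_interior _ (hK.interior_inter_nonempty hO hx hxO)).ne'
    (measure_mono inter_subset_left |>.trans_lt hK.1.measure_lt_top).ne

lemma mem_convexHull_insert_iff {n : ℕ} {K : Set (EuclideanSpace ℝ (Fin n))}
    (hK : Convex ℝ K) (hne : K.Nonempty) {P x : EuclideanSpace ℝ (Fin n)} :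
    x ∈ convexHull ℝ (insert P K) ↔ ∃ k ∈ K, ∃ s : ℝ, 0 ≤ s ∧ s ≤ 1 ∧ x = P + s • (k - P) := by
  rw [convexHull_insert hne, hK.convexHull_eq, mem_convexJoin]
  simp only [mem_singleton_iff, exists_eq_left, segment_eq_image', mem_image, mem_Icc, and_assoc,
    eq_comm (a := x)]

lemma IsConvexBody.convexHull_insert {n : ℕ} {K : Set (EuclideanSpace ℝ (Fin n))}
    (hK : IsConvexBody K) (P : EuclideanSpace ℝ (Fin n)) :
    IsConvexBody (convexHull ℝ (insert P K)) := by
  have hsub : K ⊆ convexHull ℝ (insert P K) :=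
    (subset_insert P K).trans (subset_convexHull ℝ _)
  refine ⟨?_, convex_convexHull ℝ _, hK.2.2.mono (interior_mono hsub)⟩
  have : convexHull ℝ (insert P K) =
      (fun p : ℝ × EuclideanSpace ℝ (Fin n) => P + p.1 • (p.2 - P)) '' (Icc (0 : ℝ) 1 ×ˢ K) := by
    ext x
    rw [mem_convexHull_insert_iff hK.2.1 (hK.2.2.mono interior_subset)]
    constructor
    · rintro ⟨k, hk, s, hs0, hs1, rfl⟩
      exact ⟨(s, k), ⟨⟨hs0, hs1⟩, hk⟩, rfl⟩
    · rintro ⟨⟨s, k⟩, ⟨⟨hs0, hs1⟩, hk⟩, rfl⟩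
      exact ⟨k, hk, s, hs0, hs1, rfl⟩
  rw [this]
  exact (isCompact_Icc.prod hK.1).image (by fun_prop)

lemma IsConvexBody.exists_visible {n : ℕ} {K : Set (EuclideanSpace ℝ (Fin n))}
    (hK : IsConvexBody K) {P x : EuclideanSpace ℝ (Fin n)} (hP : P ∉ K)
    (hx : x ∈ convexHull ℝ (insert P K)) (hxK : x ∉ K) :
    ∃ b ∈ K, (∀ r : ℝ, 0 ≤ r → r < 1 → P + r • (b - P) ∉ K) ∧
      ∃ s : ℝ, 0 ≤ s ∧ s ≤ 1 ∧ x = P + s • (b - P) := by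
  obtain ⟨k, hk, τ, hτ0, hτ1, rfl⟩ :=
    (mem_convexHull_insert_iff hK.2.1 (hK.2.2.mono interior_subset)).1 hx
  obtain ⟨s, hs0, hs1, hsK, -, hout⟩ := exists_first_entry hK.1.isClosed hP hk
  have hτs : τ < s := by
    by_contra! hle
    apply hxK
    rcases hs1.eq_or_lt with rfl | hs1
    · rwa [show τ = 1 by linarith]
    · have := hK.2.1.add_smul_sub_mem hsK hk (t := (τ - s) / (1 - s))
        ⟨div_nonneg (by linarith) (by linarith), by rw [div_le_one (by linarith)]; linarith⟩
      convert this using 1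
      have h1 : 1 - s ≠ 0 := by linarith
      have h2 : τ = s + (τ - s) / (1 - s) * (1 - s) := by field_simp; ring
      conv_lhs => rw [h2]
      module
  refine ⟨_, hsK, fun r hr0 hr1 => ?_, τ / s, by positivity, by rw [div_le_one hs0]; exact hτs.le,
    ?_⟩
  · have := hout (r * s) (by positivity) (by nlinarith)
    convert this using 3
    module
  · have h2 : τ = τ / s * s := by field_simp
    conv_lhs => rw [h2]
    module

lemma norm_sq_add_add_smul {n : ℕ} {T N Y : EuclideanSpace ℝ (Fin n)} (hN : ‖N‖ = 1)
    (hT : ⟪T, N⟫_ℝ = 0) (hY : ⟪Y, N⟫_ℝ = 0) (ν y : ℝ) :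
    ‖T + ν • N + Y + y • N‖ ^ 2 =
      ‖T + ν • N‖ ^ 2 + 2 * ⟪Y, T⟫_ℝ + 2 * ν * y + ‖Y‖ ^ 2 + y ^ 2 := by
  have hNN : ⟪N, N⟫_ℝ = 1 := by rw [real_inner_self_eq_norm_sq, hN]; norm_num
  rw [← real_inner_self_eq_norm_sq, ← real_inner_self_eq_norm_sq, ← real_inner_self_eq_norm_sq]
  simp only [inner_add_left, inner_add_right, real_inner_smul_left, real_inner_smul_right, hNN, hT,
    hY, real_inner_comm T N, real_inner_comm Y N, real_inner_comm Y T]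
  ring

namespace ParaboloidBounds

variable {n : ℕ} {K : Set (EuclideanSpace ℝ (Fin n))} {X₀ N : EuclideanSpace ℝ (Fin n)}
  {q : QuadraticForm ℝ (EuclideanSpace ℝ (Fin n))} {a θ : ℝ}

lemma exists_cut (h : ParaboloidBounds K X₀ N q a θ) (hK : IsConvexBody K)
    {T : EuclideanSpace ℝ (Fin n)} (hT : T ≠ 0) (hTN : ⟪T, N⟫_ℝ = 0) :
    ∃ A > (0 : ℝ), ∃ t₁ > (0 : ℝ), ∀ t, 0 < t → t < t₁ → ∃ K', IsConvexBody K' ∧ X₀ ∈ K' ∧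
      K' ⊆ K ∧ 0 < volume.real (K \ K') ∧ ∀ (Y : EuclideanSpace ℝ (Fin n)) (y : ℝ),
        ⟪Y, N⟫_ℝ = 0 → X₀ + Y + y • N ∈ K \ K' →
        ⟪Y, T⟫_ℝ ≤ -(‖T‖ ^ 2 / 4 * t) ∧ ‖Y‖ ≤ A * t ∧ |y| ≤ A * t ^ 2 := by
  obtain ⟨l, hl, m, hm, hlm⟩ := QuadraticForm.exists_bounds_of_pos h.pos
  have hD : 0 < ‖T‖ := norm_pos_iff.2 hT
  have hQ : 0 < q T := h.pos T hT
  have ha := h.a_pos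
  have hθ := h.θ_pos
  have hN := h.norm_eq
  set c' := 7 / 8 * θ * l with hc'
  have hc0 : 0 < c' := by positivity
  set A₁ := 4 * q T / (‖T‖ * c') with hA₁
  set A₂ := 4 * q T / ‖T‖ * A₁ with hA₂
  have hA₁0 : 0 < A₁ := by positivity
  have hA₂0 : 0 < A₂ := by positivity
  refine ⟨A₁ + A₂, by positivity, min 1 (min (a / ‖T‖) (a / (2 * q T))), by positivity, ?_⟩
  intro t ht0 ht
  simp only [lt_min_iff] at ht
  obtain ⟨ht1, ht2, ht3⟩ := ht
  rw [lt_div_iff₀ hD] at ht2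
  rw [lt_div_iff₀ (by positivity)] at ht3
  set s := 4 * t * q T / ‖T‖ ^ 2 with hs
  have hs0 : 0 < s := by positivity
  have hsD : s * ‖T‖ ^ 2 = 4 * t * q T := by rw [hs]; field_simp
  set ℓ : EuclideanSpace ℝ (Fin n) → ℝ := fun x => ⟪x - X₀, N + s • T⟫_ℝ with hℓ
  have hℓc : Continuous ℓ := by fun_prop
  have hℓv : ∀ (Y : EuclideanSpace ℝ (Fin n)) (y : ℝ), ⟪Y, N⟫_ℝ = 0 →
      ℓ (X₀ + Y + y • N) = y + s * ⟪Y, T⟫_ℝ := by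
    intro Y y hY
    simp only [hℓ]
    rw [inner_add_right, inner_add_add_smul_sub hN hY,
      show X₀ + Y + y • N - X₀ = Y + y • N by abel, real_inner_smul_right, inner_add_left,
      real_inner_smul_left, real_inner_comm T N, hTN]
    ring
  set b := -(t ^ 2 * q T) with hb
  have hb0 : b < 0 := by rw [hb, neg_lt_zero]; positivity
  have hℓ0 : ℓ X₀ = 0 := by simp [hℓ]
  have hdiff : K \ (K ∩ {x | b ≤ ℓ x}) = K ∩ {x | ℓ x < b} := by
    ext x; simp +contextual
  refine ⟨K ∩ {x | b ≤ ℓ x}, ⟨hK.1.inter_right (isClosed_le continuous_const hℓc), ?_, ?_⟩,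
    ⟨h.mem, by simp [hℓ0, hb0.le]⟩, inter_subset_left, ?_, ?_⟩
  · refine hK.2.1.inter fun x hx y hy u v hu hv huv => ?_
    simp only [mem_ofPred_eq] at hx hy ⊢
    have : ℓ (u • x + v • y) = u * ℓ x + v * ℓ y := by
      simp only [hℓ]
      rw [← real_inner_smul_left, ← real_inner_smul_left, ← inner_add_left]
      congr 1
      have : X₀ = (u + v) • X₀ := by rw [huv, one_smul]
      nth_rewrite 1 [this]
      module
    rw [this]
    have h1 : b = u * b + v * b := by rw [← add_mul, huv, one_mul]
    rw [h1]
    gcongr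
  · refine (hK.interior_inter_nonempty (isOpen_lt continuous_const hℓc) h.mem
      (show b < ℓ X₀ by rw [hℓ0]; exact hb0)).mono (interior_mono ?_)
    exact inter_subset_inter_right _ fun x (hx : b < ℓ x) => show b ≤ ℓ x from hx.le
  · rw [hdiff]
    have hTt : ⟪-(t • T), N⟫_ℝ = 0 := by rw [inner_neg_left, real_inner_smul_left, hTN]; simp
    refine hK.volume_real_inter_pos (isOpen_lt hℓc continuous_const)
      (h.upper (-(t • T)) (2 * (t * t * q T)) hTt ?_ ?_ ?_) ?_
    · rwa [norm_neg, norm_smul, Real.norm_eq_abs, abs_of_pos ht0]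
    · rw [abs_of_pos (by positivity)]
      have : t * (t * q T) ≤ 1 * (t * q T) := by gcongr
      linarith
    · rw [QuadraticMap.map_neg, QuadraticMap.map_smul, smul_eq_mul]
      have : 0 < t * t * q T := by positivity
      linarith
    · rw [mem_ofPred_eq, hℓv _ _ hTt, inner_neg_left, real_inner_smul_left,
        real_inner_self_eq_norm_sq]
      have : 0 < t ^ 2 * q T := by positivity
      have h2 : s * -(t * ‖T‖ ^ 2) = -(t * (s * ‖T‖ ^ 2)) := by ring
      rw [h2, hsD, hb]
      nlinarith
  · intro Y y hY hmem
    rw [hdiff] at hmem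
    obtain ⟨hmK, hlt⟩ := hmem
    rw [mem_ofPred_eq, hℓv Y y hY] at hlt
    have hy0 := h.height_nonneg hY hmK
    have hlow := h.global_lower hK.2.1 hY hmK
    have hin : ⟪Y, T⟫_ℝ < -(‖T‖ ^ 2 / 4 * t) := by
      have h1 : s * ⟪Y, T⟫_ℝ < s * (-(‖T‖ ^ 2 / 4 * t)) := by
        have : s * (-(‖T‖ ^ 2 / 4 * t)) = b := by
          rw [hb]; linear_combination (-t / 4) * hsD
        linarith
      exact lt_of_mul_lt_mul_left h1 hs0.le
    have hYT := neg_le_of_abs_le (abs_real_inner_le_norm Y T)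
    have hY0 : 0 < ‖Y‖ := by
      rw [norm_pos_iff]
      rintro rfl
      rw [inner_zero_left] at hin
      have : 0 < ‖T‖ ^ 2 / 4 * t := by positivity
      linarith
    have hys : y ≤ s * (‖Y‖ * ‖T‖) := by nlinarith
    have hcy : c' * ‖Y‖ ^ 2 ≤ y := by
      have := (hlm Y).1
      have : 7 / 8 * θ * (l * ‖Y‖ ^ 2) ≤ 7 / 8 * θ * q Y := by gcongr
      have h2 : c' * ‖Y‖ ^ 2 = 7 / 8 * θ * (l * ‖Y‖ ^ 2) := by rw [hc']; ring
      linarith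
    have hsT : s * ‖T‖ = 4 * q T / ‖T‖ * t := by rw [hs]; field_simp
    have hYA : ‖Y‖ ≤ A₁ * t := by
      have h1 : c' * ‖Y‖ ≤ s * ‖T‖ := by
        refine le_of_mul_le_mul_right ?_ hY0
        linarith
      have h2 : A₁ * t = s * ‖T‖ / c' := by rw [hsT, hA₁]; field_simp
      rw [h2, le_div_iff₀ hc0]
      linarith
    refine ⟨hin.le, hYA.trans ?_, ?_⟩
    · gcongr; linarith
    · rw [abs_of_nonneg hy0]
      calc y ≤ (s * ‖T‖) * ‖Y‖ := by linarith
        _ ≤ (s * ‖T‖) * (A₁ * t) := by gcongr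
        _ = A₂ * t ^ 2 := by rw [hsT, hA₂]; ring
        _ ≤ _ := by gcongr; linarith

end ParaboloidBounds

lemma QuadraticForm.exists_polar_eq_inner {n : ℕ}
    {q : QuadraticForm ℝ (EuclideanSpace ℝ (Fin n))} (hq : ∀ x, x ≠ 0 → 0 < q x)
    (T : EuclideanSpace ℝ (Fin n)) : ∃ U, ∀ Y, QuadraticMap.polar q U Y = ⟪T, Y⟫_ℝ := by
  have hinj : Function.Injective q.polarBilin := by
    rw [← LinearMap.ker_eq_bot, LinearMap.ker_eq_bot']
    intro x hx
    by_contra hne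
    have h1 : q.polarBilin x x = 0 := by rw [hx]; rfl
    rw [QuadraticMap.polarBilin_apply_apply, QuadraticMap.polar_self, two_nsmul] at h1
    linarith [hq x hne]
  have hsurj : Function.Surjective q.polarBilin :=
    (LinearMap.injective_iff_surjective_of_finrank_eq_finrank
      (Subspace.dual_finrank_eq (K := ℝ) (V := EuclideanSpace ℝ (Fin n))).symm).1 hinj
  obtain ⟨U, hU⟩ := hsurj (innerSL ℝ T).toLinearMap
  refine ⟨U, fun Y => ?_⟩
  rw [← QuadraticMap.polarBilin_apply_apply, hU]
  simp

lemma QuadraticForm.map_add_le {E : Type*} [AddCommGroup E] [Module ℝ E] {q : QuadraticForm ℝ E}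
    (hq : ∀ x, 0 ≤ q x) (x y : E) : q (x + y) ≤ 2 * q x + 2 * q y := by
  have h1 := hq (x + -y)
  rw [QuadraticMap.map_add q, QuadraticMap.map_neg, QuadraticMap.polar_neg_right] at h1
  rw [QuadraticMap.map_add q]
  linarith

namespace ParaboloidBounds

variable {n : ℕ} {K : Set (EuclideanSpace ℝ (Fin n))} {X₀ N : EuclideanSpace ℝ (Fin n)}
  {q : QuadraticForm ℝ (EuclideanSpace ℝ (Fin n))} {a θ : ℝ}

lemma le_of_notMem (h : ParaboloidBounds K X₀ N q a θ) {Y : EuclideanSpace ℝ (Fin n)} {y : ℝ}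
    (hY : ⟪Y, N⟫_ℝ = 0) (hYa : ‖Y‖ < a) (hya : |y| < a) (hm : X₀ + Y + y • N ∉ K) :
    y ≤ 9 / 8 * q Y := by
  by_contra! hlt
  exact hm (h.upper Y y hY hYa hya hlt)

lemma visible_bounds (h : ParaboloidBounds K X₀ N q a θ) (hK : Convex ℝ K)
    {W Z : EuclideanSpace ℝ (Fin n)} {w z : ℝ} (hW : ⟪W, N⟫_ℝ = 0) (hZ : ⟪Z, N⟫_ℝ = 0)
    (hWa : ‖W‖ < a / 2) (hw0 : 0 ≤ w) (hwa : w < a / 2) (hm : X₀ + Z + z • N ∈ K)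
    (hvis : ∀ r : ℝ, 0 ≤ r → r < 1 →
      X₀ + ((1 - r) • W + r • Z) + ((1 - r) * w + r * z) • N ∉ K) :
    θ ^ 2 * q Z ≤ 29 * q W ∧ θ * z ≤ 28 * q W := by
  have hθ := h.θ_pos
  have hθ1 := h.θ_le
  have hz := h.height_nonneg hZ hm
  have hlow := h.global_lower hK hZ hm
  obtain ⟨h1, h2⟩ := h.shrink Z z hZ hm
  rw [abs_of_nonneg hz] at h2
  have hnot := hvis (θ / 4) (by positivity) (by linarith)
  have hr : 0 ≤ 1 - θ / 4 := by linarith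
  have key := h.le_of_notMem (Y := (1 - θ / 4) • W + (θ / 4) • Z)
    (by rw [inner_add_left, real_inner_smul_left, real_inner_smul_left, hW, hZ]; simp)
    (by
      refine (norm_add_le _ _).trans_lt ?_
      rw [norm_smul, norm_smul, Real.norm_eq_abs, Real.norm_eq_abs, abs_of_nonneg hr,
        abs_of_nonneg (by positivity)]
      nlinarith [norm_nonneg W])
    (by
      rw [abs_of_nonneg (by positivity)]
      nlinarith)
    hnot
  have hadd := QuadraticForm.map_add_le h.nonneg ((1 - θ / 4) • W) ((θ / 4) • Z)
  rw [QuadraticMap.map_smul, QuadraticMap.map_smul, smul_eq_mul, smul_eq_mul] at hadd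
  have hqW := h.nonneg W
  have hqZ := h.nonneg Z
  have h3 : (1 - θ / 4) * (1 - θ / 4) * q W ≤ 1 * 1 * q W := by gcongr <;> linarith
  have h4 : 0 ≤ (1 - θ / 4) * w := by positivity
  have h5 : θ * (7 / 8 * θ * q Z) ≤ θ * z := by gcongr
  constructor <;> nlinarith

lemma midpoint_bound (h : ParaboloidBounds K X₀ N q a θ)
    {W Z : EuclideanSpace ℝ (Fin n)} {z : ℝ} (hW : ⟪W, N⟫_ℝ = 0) (hZ : ⟪Z, N⟫_ℝ = 0)
    (hWa : ‖W‖ < a) (hwa : 3 / 4 * q W < a) (hZa : ‖Z‖ < a) (hz0 : 0 ≤ z) (hza : z < a)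
    (hm : X₀ + Z + z • N ∈ K)
    (hvis : X₀ + ((1 / 2 : ℝ) • (W + Z)) + (1 / 2 * (3 / 4 * q W + z)) • N ∉ K) :
    q W / 3 ≤ QuadraticMap.polar q W Z := by
  have hqW := h.nonneg W
  have hqZ := h.nonneg Z
  have hlow := h.lower Z z hZ hZa (by rwa [abs_of_nonneg hz0]) hm
  have key := h.le_of_notMem
    (by rw [real_inner_smul_left, inner_add_left, hW, hZ]; simp)
    (by
      rw [norm_smul, Real.norm_eq_abs, abs_of_pos (by norm_num)]
      linarith [norm_add_le W Z])
    (by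
      rw [abs_of_nonneg (by positivity)]
      linarith)
    hvis
  rw [QuadraticMap.map_smul, smul_eq_mul, QuadraticMap.map_add q] at key
  linarith

lemma exists_spike (h : ParaboloidBounds K X₀ N q a θ) (hK : IsConvexBody K)
    (hpolar : ∀ Y, ⟪Y, N⟫_ℝ = 0 → QuadraticMap.polar q Y N = 0)
    {T : EuclideanSpace ℝ (Fin n)} (hT : T ≠ 0) (hTN : ⟪T, N⟫_ℝ = 0) :
    ∃ κ > (0 : ℝ), ∃ A > (0 : ℝ), ∃ t₁ > (0 : ℝ), ∀ t, 0 < t → t < t₁ →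
      ∃ K', IsConvexBody K' ∧ K ⊆ K' ∧ 0 < volume.real (K' \ K) ∧
        ∀ (Y : EuclideanSpace ℝ (Fin n)) (y : ℝ), ⟪Y, N⟫_ℝ = 0 → X₀ + Y + y • N ∈ K' \ K →
          κ * t ≤ ⟪Y, T⟫_ℝ ∧ ‖Y‖ ≤ A * t ∧ |y| ≤ A * t ^ 2 := by
  obtain ⟨l, hl, m, hm, hlm⟩ := QuadraticForm.exists_bounds_of_pos h.pos
  obtain ⟨U, hU⟩ := QuadraticForm.exists_polar_eq_inner h.pos T
  have ha := h.a_pos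
  have hθ := h.θ_pos
  have hN := h.norm_eq
  have hU0 : U ≠ 0 := by
    rintro rfl
    have := hU T
    rw [QuadraticMap.polar_zero_left, real_inner_self_eq_norm_sq] at this
    exact hT (norm_eq_zero.1 (pow_eq_zero_iff two_ne_zero |>.1 this.symm))
  have hUN : ⟪U, N⟫_ℝ = 0 := by
    obtain ⟨V, α, hV, hdec⟩ := exists_eq_add_add_smul 0 hN U
    have h1 := hU N
    rw [hTN, hdec, zero_add, QuadraticMap.polar_add_left, hpolar V hV, zero_add,
      QuadraticMap.polar_smul_left, QuadraticMap.polar_self, smul_eq_mul, two_nsmul] at h1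
    have h2 : 0 < q N := h.pos N (by rw [← norm_pos_iff, hN]; exact one_pos)
    have h3 : α = 0 := by
      rcases mul_eq_zero.1 h1 with h3 | h3
      · exact h3
      · linarith
    rw [hdec, h3, zero_add, zero_smul, add_zero, hV]
  have hqU : 0 < q U := h.pos U hU0
  have hUn : 0 < ‖U‖ := norm_pos_iff.2 hU0
  have hTU : ⟪T, U⟫_ℝ = 2 * q U := by
    rw [← hU, QuadraticMap.polar_self, two_nsmul, two_mul]
  set A₁ := √(29 * q U / (θ ^ 2 * l)) with hA₁
  set A₂ := 28 * q U / θ with hA₂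
  have hA₁0 : 0 < A₁ := Real.sqrt_pos.2 (by positivity)
  have hA₂0 : 0 < A₂ := by positivity
  have hA₁sq : A₁ ^ 2 = 29 * q U / (θ ^ 2 * l) := Real.sq_sqrt (by positivity)
  refine ⟨q U / 3, by positivity, ‖U‖ + A₁ + (q U + A₂), by positivity,
    min (min 1 (a / (2 * ‖U‖))) (min (a / (2 * q U)) (min (a / A₁) (a / A₂))), by positivity, ?_⟩
  intro t ht0 ht
  simp only [lt_min_iff] at ht
  obtain ⟨⟨ht1, ht2⟩, ht3, ht4, ht5⟩ := ht
  rw [lt_div_iff₀ (by positivity)] at ht2 ht3 ht4 ht5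
  have htt : ∀ x : ℝ, 0 ≤ x → t ^ 2 * x ≤ t * x := fun x hx => by
    have : t ^ 2 ≤ t := by nlinarith
    gcongr
  obtain ⟨W, hWdef⟩ : ∃ W, W = t • U := ⟨_, rfl⟩
  have hW : ⟪W, N⟫_ℝ = 0 := by rw [hWdef, real_inner_smul_left, hUN, mul_zero]
  have hqW : q W = t ^ 2 * q U := by rw [hWdef, QuadraticMap.map_smul, smul_eq_mul]; ring
  have hqW0 : 0 < q W := by rw [hqW]; positivity
  have hWn : ‖W‖ = t * ‖U‖ := by rw [hWdef, norm_smul, Real.norm_eq_abs, abs_of_pos ht0]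
  have hqWa : q W < a / 2 := by rw [hqW]; linarith [htt _ hqU.le]
  obtain ⟨w, hw⟩ : ∃ w, w = 3 / 4 * q W := ⟨_, rfl⟩
  have hw0 : 0 < w := by rw [hw]; positivity
  have hWa : ‖W‖ < a / 2 := by rw [hWn]; linarith
  obtain ⟨P, hPdef⟩ : ∃ P, P = X₀ + W + w • N := ⟨_, rfl⟩
  have hP : P ∉ K := fun hc => by
    rw [hPdef] at hc
    have := h.lower W w hW (by linarith) (by rw [abs_of_pos hw0]; linarith) hc
    linarith
  refine ⟨convexHull ℝ (insert P K), hK.convexHull_insert P,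
    (subset_insert P K).trans (subset_convexHull ℝ _), ?_, ?_⟩
  · rw [sdiff_eq]
    exact (hK.convexHull_insert P).volume_real_inter_pos hK.1.isClosed.isOpen_compl
      (subset_convexHull ℝ _ (mem_insert P K)) hP
  · intro Y y hY hmem
    obtain ⟨b, hb, hvis, τ, hτ0, hτ1, hx⟩ := hK.exists_visible hP hmem.1 hmem.2
    obtain ⟨Z, z, hZ, rfl⟩ := exists_eq_add_add_smul X₀ hN b
    have hcomb : ∀ r : ℝ, P + r • (X₀ + Z + z • N - P) =
        X₀ + ((1 - r) • W + r • Z) + ((1 - r) * w + r * z) • N := fun r => by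
      rw [hPdef]; module
    have horth : ∀ r : ℝ, ⟪(1 - r) • W + r • Z, N⟫_ℝ = 0 := fun r => by
      rw [inner_add_left, real_inner_smul_left, real_inner_smul_left, hW, hZ]; simp
    have hvis' : ∀ r : ℝ, 0 ≤ r → r < 1 →
        X₀ + ((1 - r) • W + r • Z) + ((1 - r) * w + r * z) • N ∉ K := fun r h0 h1 => by
      rw [← hcomb]; exact hvis r h0 h1
    have hz0 := h.height_nonneg hZ hb
    obtain ⟨hbZ, hbz⟩ := h.visible_bounds hK.2.1 hW hZ hWa hw0.le (by linarith) hb hvis'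
    have hzA : z ≤ A₂ * t ^ 2 := by
      have : A₂ * t ^ 2 = 28 * q W / θ := by rw [hqW, hA₂]; ring
      rw [this, le_div_iff₀ hθ]
      linarith
    have hZA : ‖Z‖ ≤ A₁ * t := by
      refine le_of_sq_le_sq ?_ (by positivity)
      have : (A₁ * t) ^ 2 = 29 * q W / (θ ^ 2 * l) := by rw [mul_pow, hA₁sq, hqW]; ring
      rw [this, le_div_iff₀ (by positivity)]
      have : θ ^ 2 * (l * ‖Z‖ ^ 2) ≤ θ ^ 2 * q Z := by gcongr; exact (hlm Z).1
      linarith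
    have hmid := h.midpoint_bound hW hZ (by linarith) (by linarith) (by linarith) hz0
      (by linarith [htt _ hA₂0.le]) hb (by
        have := hvis' (1 / 2) (by norm_num) (by norm_num)
        rw [hw] at this
        convert this using 2
        module)
    have hTZ : q U / 3 * t ≤ ⟪Z, T⟫_ℝ := by
      rw [hqW, hWdef, QuadraticMap.polar_smul_left, hU, smul_eq_mul, real_inner_comm] at hmid
      refine le_of_mul_le_mul_left ?_ ht0
      linarith
    have hTW : q U / 3 * t ≤ ⟪W, T⟫_ℝ := by
      rw [hWdef, real_inner_smul_left, real_inner_comm, hTU]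
      nlinarith
    rw [hcomb] at hx
    have hyy : y = (1 - τ) * w + τ * z := by
      rw [← inner_add_add_smul_sub (X₀ := X₀) hN hY y, hx, inner_add_add_smul_sub hN (horth τ)]
    have hYY : Y = (1 - τ) • W + τ • Z := by
      rw [hyy] at hx
      simpa using hx
    have hτ' : 0 ≤ 1 - τ := by linarith
    refine ⟨?_, ?_, ?_⟩
    · rw [hYY, inner_add_left, real_inner_smul_left, real_inner_smul_left]
      have h1 := mul_le_mul_of_nonneg_left hTW hτ'
      have h2 := mul_le_mul_of_nonneg_left hTZ hτ0
      linarith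
    · rw [hYY]
      refine (norm_add_le _ _).trans ?_
      rw [norm_smul, norm_smul, Real.norm_eq_abs, Real.norm_eq_abs, abs_of_nonneg hτ',
        abs_of_nonneg hτ0]
      have h1 : (1 - τ) * ‖W‖ ≤ 1 * (t * ‖U‖) := by rw [hWn]; gcongr; linarith
      have h2 : τ * ‖Z‖ ≤ 1 * (A₁ * t) := by gcongr
      have h3 : 0 < (q U + A₂) * t := by positivity
      linarith
    · rw [hyy, abs_of_nonneg (by positivity)]
      have h1 : (1 - τ) * w ≤ 1 * w := by gcongr; linarith
      have h2 : τ * z ≤ 1 * (A₂ * t ^ 2) := by gcongr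
      have h3 : w ≤ q U * t ^ 2 := by rw [hw, hqW]; linarith [mul_pos (pow_pos ht0 2) hqU]
      have h4 : 0 < (‖U‖ + A₁) * t ^ 2 := by positivity
      linarith

end ParaboloidBounds

lemma exists_const_mul_sq_le {B κ : ℝ} (hκ : 0 < κ) :
    ∃ t₀ > (0 : ℝ), ∀ t, 0 < t → t < t₀ → t < 1 ∧ B * t ^ 2 ≤ κ * t := by
  refine ⟨min 1 (κ / (|B| + 1)), by positivity, fun t ht0 ht => ?_⟩
  rw [lt_min_iff, lt_div_iff₀ (by positivity)] at ht
  refine ⟨ht.1, ?_⟩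
  have h1 : B * t ^ 2 ≤ (|B| + 1) * t ^ 2 := by gcongr; linarith [le_abs_self B]
  have h2 := mul_le_mul_of_nonneg_left ht.2.le ht0.le
  linarith

/-- At a point of positive curvature of a local maximizer, the position vector is normal. -/
lemma IsLocalMaxIso.eq_smul_of_paraboloidBounds {n : ℕ} {K : Set (EuclideanSpace ℝ (Fin n))}
    {M : ℝ} (hK : IsConvexBody K) (hiso : IsIsotropic K M) (hmax : IsLocalMaxIso K)
    {X₀ N : EuclideanSpace ℝ (Fin n)} {q : QuadraticForm ℝ (EuclideanSpace ℝ (Fin n))} {a θ : ℝ}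
    (h : ParaboloidBounds K X₀ N q a θ)
    (hpolar : ∀ Y, ⟪Y, N⟫_ℝ = 0 → QuadraticMap.polar q Y N = 0) : ∃ ν : ℝ, X₀ = ν • N := by
  have hN := h.norm_eq
  have hX₀ := h.mem
  obtain ⟨T, ν, hTN, hdec⟩ := exists_eq_add_add_smul 0 hN X₀
  rw [zero_add] at hdec
  refine ⟨ν, ?_⟩
  by_contra hne
  have hT : T ≠ 0 := by
    rintro rfl
    exact hne (by rw [hdec, zero_add])
  have hn : 2 ≤ n := by
    by_contra! hlt
    have hle : Module.finrank ℝ (EuclideanSpace ℝ (Fin n)) ≤ 1 := by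
      rw [finrank_euclideanSpace_fin]; omega
    obtain ⟨v, hv⟩ := finrank_le_one_iff.1 hle
    obtain ⟨α, hα⟩ := hv T
    obtain ⟨β, hβ⟩ := hv N
    have hα0 : α ≠ 0 := by rintro rfl; exact hT (by rw [← hα, zero_smul])
    have hβ0 : β ≠ 0 := by
      rintro rfl
      rw [← hβ, zero_smul, norm_zero] at hN
      exact zero_ne_one hN
    rw [← hα, ← hβ, real_inner_smul_left, real_inner_smul_right] at hTN
    have hv0 : v = 0 := by simpa [hα0, hβ0] using hTN
    exact hT (by rw [← hα, hv0, smul_zero])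
  have hnorm : ∀ (Y : EuclideanSpace ℝ (Fin n)) (y : ℝ), ⟪Y, N⟫_ℝ = 0 →
      ‖X₀ + Y + y • N‖ ^ 2 = ‖X₀‖ ^ 2 + 2 * ⟪Y, T⟫_ℝ + 2 * ν * y + ‖Y‖ ^ 2 + y ^ 2 :=
    fun Y y hY => by rw [hdec, norm_sq_add_add_smul hN hTN hY]
  have hball : ∀ {A t y : ℝ} {Y : EuclideanSpace ℝ (Fin n)}, 0 < A → 0 < t → t < 1 →
      ‖Y‖ ≤ A * t → |y| ≤ A * t ^ 2 → X₀ + Y + y • N ∈ closedBall X₀ (2 * A * t) := by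
    intro A t y Y hA ht0 ht1 hY hy
    rw [mem_closedBall, dist_eq_norm, show X₀ + Y + y • N - X₀ = Y + y • N by abel]
    have h1 : A * t ^ 2 ≤ A * t := by
      have : t ^ 2 ≤ t := by nlinarith
      gcongr
    linarith [norm_add_smul_le hN y (Y := Y)]
  have hνy : ∀ {B y : ℝ}, |y| ≤ B → |2 * ν * y| ≤ 2 * |ν| * B := by
    intro B y hy
    rw [abs_mul, abs_mul, abs_two]
    gcongr
  rcases le_total (‖X₀‖ ^ 2) ((n + 2) * M ^ 2 / (volume K).toReal) with hc | hc
  · obtain ⟨A, hA, t₁, ht₁, H⟩ := h.exists_cut hK hT hTN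
    have hκ : 0 < ‖T‖ ^ 2 / 4 := by have := norm_pos_iff.2 hT; positivity
    obtain ⟨t₂, ht₂, G⟩ := hmax.no_small_gain hn hK hiso hX₀ (A := 2 * A) (by positivity) hκ
    obtain ⟨t₃, ht₃, S⟩ := exists_const_mul_sq_le (B := 2 * |ν| * A + 2 * A ^ 2) hκ
    obtain ⟨t, ht0, ht⟩ := exists_between (lt_min ht₁ (lt_min ht₂ ht₃))
    simp only [lt_min_iff] at ht
    obtain ⟨hta, htb, htc⟩ := ht
    obtain ⟨ht1, htS⟩ := S t ht0 htc
    obtain ⟨K', hK', hX', hsub, hpos, hbd⟩ := H t ht0 hta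
    have hempty : K' \ K = ∅ := sdiff_eq_empty.2 hsub
    refine G t ht0 htb K' hK' hX' (by simp [hempty]) ?_ (by simp [hempty]) ?_
      (by simpa [hempty] using hpos)
    · intro x hx
      obtain ⟨Y, y, hY, rfl⟩ := exists_eq_add_add_smul X₀ hN x
      obtain ⟨-, h2, h3⟩ := hbd Y y hY hx
      exact hball hA ht0 ht1 h2 h3
    · intro x hx
      obtain ⟨Y, y, hY, rfl⟩ := exists_eq_add_add_smul X₀ hN x
      obtain ⟨h1, h2, h3⟩ := hbd Y y hY hx
      rw [hnorm Y y hY]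
      have h4 := (abs_le.1 (hνy h3)).2
      have h5 : ‖Y‖ ^ 2 ≤ (A * t) ^ 2 := by gcongr
      have h6 : y ^ 2 ≤ (A * t) ^ 2 := by
        rw [sq_le_sq, abs_of_pos (by positivity : 0 < A * t)]
        have : A * t ^ 2 ≤ A * t := by
          have : t ^ 2 ≤ t := by nlinarith
          gcongr
        linarith
      nlinarith
  · obtain ⟨κ, hκ, A, hA, t₁, ht₁, H⟩ := h.exists_spike hK hpolar hT hTN
    obtain ⟨t₂, ht₂, G⟩ := hmax.no_small_gain hn hK hiso hX₀ (A := 2 * A) (by positivity) hκ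
    obtain ⟨t₃, ht₃, S⟩ := exists_const_mul_sq_le (B := 2 * |ν| * A) hκ
    obtain ⟨t, ht0, ht⟩ := exists_between (lt_min ht₁ (lt_min ht₂ ht₃))
    simp only [lt_min_iff] at ht
    obtain ⟨hta, htb, htc⟩ := ht
    obtain ⟨ht1, htS⟩ := S t ht0 htc
    obtain ⟨K', hK', hsub, hpos, hbd⟩ := H t ht0 hta
    have hempty : K \ K' = ∅ := sdiff_eq_empty.2 hsub
    refine G t ht0 htb K' hK' (hsub hX₀) ?_ (by simp [hempty]) ?_ (by simp [hempty])
      (by simpa [hempty] using hpos)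
    · intro x hx
      obtain ⟨Y, y, hY, rfl⟩ := exists_eq_add_add_smul X₀ hN x
      obtain ⟨-, h2, h3⟩ := hbd Y y hY hx
      exact hball hA ht0 ht1 h2 h3
    · intro x hx
      obtain ⟨Y, y, hY, rfl⟩ := exists_eq_add_add_smul X₀ hN x
      obtain ⟨h1, h2, h3⟩ := hbd Y y hY hx
      rw [hnorm Y y hY]
      have h4 := (abs_le.1 (hνy h3)).1
      nlinarith [sq_nonneg ‖Y‖, sq_nonneg y]

/-- The centroid of an isotropic convex body lies strictly on the inner side of each of its
supporting hyperplanes. -/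
lemma IsIsotropic.inner_neg_of_curvWitness {n : ℕ} {K : Set (EuclideanSpace ℝ (Fin n))} {M : ℝ}
    (hK : IsConvexBody K) (hiso : IsIsotropic K M) {X₀ N : EuclideanSpace ℝ (Fin n)}
    {q : QuadraticForm ℝ (EuclideanSpace ℝ (Fin n))} (h : CurvWitness K X₀ N q) :
    ⟪X₀, N⟫_ℝ < 0 := by
  have hv := hK.toReal_volume_pos
  have hint : IntegrableOn (fun x : EuclideanSpace ℝ (Fin n) => x) K :=
    continuous_id.continuousOn.integrableOn_compact hK.1
  have hint1 : IntegrableOn (fun x => ⟪x - X₀, N⟫_ℝ) K :=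
    ContinuousOn.integrableOn_compact hK.1 (by fun_prop)
  have hint2 : IntegrableOn (fun x => ⟪N, x⟫_ℝ) K :=
    ContinuousOn.integrableOn_compact hK.1 (by fun_prop)
  have hint3 : IntegrableOn (fun _ => ⟪X₀, N⟫_ℝ) K :=
    continuous_const.continuousOn.integrableOn_compact hK.1
  have hval : ∫ x in K, ⟪x - X₀, N⟫_ℝ = -((volume K).toReal * ⟪X₀, N⟫_ℝ) := by
    have h1 : ∫ x in K, ⟪N, x⟫_ℝ = 0 := by
      rw [integral_inner hint, hiso.2.1, inner_zero_right]
    have h2 : ∀ x, ⟪x - X₀, N⟫_ℝ = ⟪N, x⟫_ℝ - ⟪X₀, N⟫_ℝ := fun x => by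
      rw [inner_sub_left, real_inner_comm]
    simp_rw [h2]
    rw [integral_sub hint2 hint3, h1, setIntegral_const, smul_eq_mul, zero_sub]
    rfl
  have hpos : 0 < ∫ x in K, ⟪x - X₀, N⟫_ℝ := by
    rw [setIntegral_pos_iff_support_of_nonneg_ae _ hint1]
    · refine (isOpen_interior.measure_pos volume hK.2.2).trans_le (measure_mono fun x hx => ?_)
      exact ⟨(h.inner_pos_of_mem_interior hx).ne', interior_subset hx⟩
    · exact (ae_restrict_iff' hK.1.measurableSet).2 (.of_forall fun x hx => h.2.1 x hx)
  rw [hval] at hpos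
  nlinarith

/-- **Lemma 8 (Meyer–Reisner).** If an isotropic convex body `K` is a local maximizer for
the isotropy constant and `∂K` has positive generalized curvature at `X₀`, then the outer
unit normal of `K` at `X₀` equals `X₀/|X₀|`. -/
theorem outer_normal_parallel_of_local_maximizer {n : ℕ}
    (K : Set (EuclideanSpace ℝ (Fin n))) (M : ℝ)
    (hK : IsConvexBody K) (hiso : IsIsotropic K M)
    (hmax : IsLocalMaxIso K)
    (X₀ : EuclideanSpace ℝ (Fin n)) (hX₀ : X₀ ∈ frontier K)
    (hcurv : HasPosGenCurvature K X₀) :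
    ∀ N : EuclideanSpace ℝ (Fin n), ‖N‖ = 1 →
      (∀ X ∈ K, ⟪X, N⟫_ℝ ≤ ⟪X₀, N⟫_ℝ) → N = ‖X₀‖⁻¹ • X₀ := by
  intro N' hN' hsupp
  obtain ⟨N, q, hw⟩ := hcurv
  obtain ⟨Q, hQ, hpos, hpolar⟩ := hw.exists_posDef
  have hmem : X₀ ∈ K := hK.1.isClosed.frontier_subset hX₀
  obtain ⟨a, θ, hP⟩ := hQ.exists_paraboloidBounds hK hmem hpos
  obtain ⟨ν, hν⟩ := hmax.eq_smul_of_paraboloidBounds hK hiso hP hpolar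
  have hneg := hiso.inner_neg_of_curvWitness hK hQ
  rw [hν, real_inner_smul_left, real_inner_self_eq_norm_sq, hQ.1, one_pow, mul_one] at hneg
  rw [hP.outer_normal_eq hN' hsupp, hν, norm_smul, hQ.1, mul_one, Real.norm_eq_abs,
    abs_of_neg hneg, smul_smul, ← div_eq_inv_mul, div_neg, div_self hneg.ne, neg_one_smul]
end
end

section
/- Fix n ≥ 2, R > 0, b ∈ ℝ and positive reals λ₁, …, λₙ, and set αₙ = (1/(n−1)) Σ_{j=1}^{n−1} λ_j^{−2}. In ℝⁿ = ℝ^{n−1} × ℝ (coordinates (Y, y), Y = (Y₁,…,Y_{n−1})) let D_a = {(Y, y) : |Y| ≤ √(2Ra), |Y|²/(2R) ≤ y ≤ a} and ψ(a) = ∫_{D_a} ( Σ_{j=1}^{n−1} Y_j²/λ_j² + y²/λₙ² − 2yb/λₙ² ) dY dy. Then as a → 0⁺: ψ(a) = (4(n−1) v_{n−1} (2R)^{(n−1)/2} / ((n+1)(n+3))) · a^{(n+3)/2} · ( αₙ R − ((n+1)/(n−1)) b/λₙ² ) + O(a^{(n+5)/2}). -/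
open MeasureTheory Metric Set Filter
open scoped Topology

noncomputable section

section Moments
variable {ι : Type*} [Fintype ι]

theorem setIntegral_closedBall_norm_sq [Nonempty ι] {r : ℝ} (hr : 0 ≤ r) :
    ∫ Y in closedBall (0 : EuclideanSpace ℝ ι) r, ‖Y‖ ^ 2 =
      Fintype.card ι * volume.real (ball (0 : EuclideanSpace ℝ ι) 1) *
        (r ^ (Fintype.card ι + 2) / (Fintype.card ι + 2)) := by
  have hcard : 0 < Fintype.card ι := Fintype.card_pos
  have key := integral_fun_norm_addHaar (volume : Measure (EuclideanSpace ℝ ι))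
    ((Iic r).indicator fun t : ℝ => t ^ 2)
  have hind : (fun Y : EuclideanSpace ℝ ι => (Iic r).indicator (fun t : ℝ => t ^ 2) ‖Y‖) =
      (closedBall (0 : EuclideanSpace ℝ ι) r).indicator fun Y => ‖Y‖ ^ 2 := by
    ext Y
    simp [indicator]
  have hrad : (fun t : ℝ => t ^ (Fintype.card ι - 1) • (Iic r).indicator (fun t : ℝ => t ^ 2) t) =
      (Iic r).indicator fun t => t ^ (Fintype.card ι + 1) := by
    ext t
    by_cases h : t ∈ Iic r
    · simp only [indicator_of_mem h, smul_eq_mul, ← pow_add]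
      congr 1
      omega
    · simp [indicator_of_notMem h]
  rw [hind, integral_indicator measurableSet_closedBall, finrank_euclideanSpace, hrad,
    setIntegral_indicator measurableSet_Iic, Ioi_inter_Iic,
    ← intervalIntegral.integral_of_le hr, integral_pow] at key
  rw [key]
  simp only [nsmul_eq_mul, smul_eq_mul]
  push_cast
  ring

theorem setIntegral_closedBall_coord_sq_eq (r : ℝ) (i j : ι) :
    ∫ Y in closedBall (0 : EuclideanSpace ℝ ι) r, Y i ^ 2 =
      ∫ Y in closedBall (0 : EuclideanSpace ℝ ι) r, Y j ^ 2 := by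
  classical
  let e := LinearIsometryEquiv.piLpCongrLeft 2 ℝ ℝ (Equiv.swap i j)
  have h := e.measurePreserving.setIntegral_preimage_emb
    e.toHomeomorph.measurableEmbedding (fun Y : EuclideanSpace ℝ ι => Y j ^ 2) (closedBall 0 r)
  rw [← h]
  have hpre : e ⁻¹' closedBall 0 r = closedBall 0 r := by
    ext Y
    simp
  rw [hpre]
  simp [e, LinearIsometryEquiv.piLpCongrLeft_apply, Equiv.piCongrLeft'_apply]

theorem integrableOn_closedBall_of_continuous {f : EuclideanSpace ℝ ι → ℝ} (hf : Continuous f)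
    (r : ℝ) : IntegrableOn f (closedBall 0 r) :=
  hf.continuousOn.integrableOn_compact (isCompact_closedBall 0 r)

theorem setIntegral_closedBall_coord_sq {r : ℝ} (hr : 0 ≤ r) (i : ι) :
    ∫ Y in closedBall (0 : EuclideanSpace ℝ ι) r, Y i ^ 2 =
      volume.real (ball (0 : EuclideanSpace ℝ ι) 1) *
        (r ^ (Fintype.card ι + 2) / (Fintype.card ι + 2)) := by
  have : Nonempty ι := ⟨i⟩
  have h := setIntegral_closedBall_norm_sq (ι := ι) hr
  simp only [EuclideanSpace.real_norm_sq_eq] at h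
  rw [integral_finsetSum _ fun j _ =>
      integrableOn_closedBall_of_continuous (by fun_prop) r,
    Finset.sum_congr rfl fun j _ => setIntegral_closedBall_coord_sq_eq r j i,
    Finset.sum_const, Finset.card_univ, nsmul_eq_mul, mul_assoc] at h
  exact mul_left_cancel₀ (by simp) h

theorem setIntegral_closedBall_quadratic {r : ℝ} (hr : 0 ≤ r) (w : ι → ℝ) (c : ℝ) :
    ∫ Y in closedBall (0 : EuclideanSpace ℝ ι) r, ((∑ j, Y j ^ 2 * w j) + c) =
      volume.real (ball (0 : EuclideanSpace ℝ ι) 1) *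
        ((∑ j, w j) * r ^ (Fintype.card ι + 2) / (Fintype.card ι + 2) +
          c * r ^ Fintype.card ι) := by
  rw [integral_add (integrableOn_closedBall_of_continuous (by fun_prop) r)
      (integrableOn_closedBall_of_continuous (by fun_prop) r),
    integral_finsetSum _ fun j _ => integrableOn_closedBall_of_continuous (by fun_prop) r]
  simp only [integral_mul_const, setIntegral_closedBall_coord_sq hr, ← Finset.mul_sum,
    setIntegral_const, smul_eq_mul]
  rw [Measure.addHaar_real_closedBall _ _ hr, finrank_euclideanSpace]
  ring

end Moments

section Cap
variable {ι : Type*} [Fintype ι]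

theorem integrableOn_paraboloidCap {R a : ℝ} (hR : 0 < R)
    {f : EuclideanSpace ℝ ι × ℝ → ℝ} (hf : Continuous f) :
    IntegrableOn f {p | ‖p.1‖ ≤ √(2 * R * a) ∧ ‖p.1‖ ^ 2 / (2 * R) ≤ p.2 ∧ p.2 ≤ a} := by
  refine (hf.continuousOn.integrableOn_compact
    ((isCompact_closedBall (0 : EuclideanSpace ℝ ι) √(2 * R * a)).prod
      (isCompact_Icc (a := (0 : ℝ)) (b := a)))).mono_set ?_
  rintro ⟨Y, y⟩ ⟨h1, h2, h3⟩
  exact ⟨by simpa using h1, le_trans (by positivity) h2, h3⟩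

theorem measurableSet_paraboloidCap (R a : ℝ) :
    MeasurableSet {p : EuclideanSpace ℝ ι × ℝ |
      ‖p.1‖ ≤ √(2 * R * a) ∧ ‖p.1‖ ^ 2 / (2 * R) ≤ p.2 ∧ p.2 ≤ a} := by
  refine IsClosed.measurableSet ?_
  have h1 : Continuous fun p : EuclideanSpace ℝ ι × ℝ => ‖p.1‖ := by fun_prop
  have h2 : Continuous fun p : EuclideanSpace ℝ ι × ℝ => ‖p.1‖ ^ 2 / (2 * R) := by fun_prop
  exact (isClosed_le h1 continuous_const).inter
    ((isClosed_le h2 continuous_snd).inter (isClosed_le continuous_snd continuous_const))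

/-- Fubini over the horizontal slices of the paraboloid cap. -/
theorem setIntegral_paraboloidCap {R a : ℝ} (hR : 0 < R)
    {f : EuclideanSpace ℝ ι × ℝ → ℝ} (hf : Continuous f) :
    ∫ p in {p : EuclideanSpace ℝ ι × ℝ |
        ‖p.1‖ ≤ √(2 * R * a) ∧ ‖p.1‖ ^ 2 / (2 * R) ≤ p.2 ∧ p.2 ≤ a}, f p =
      ∫ y in Icc 0 a, ∫ Y in closedBall 0 √(2 * R * y), f (Y, y) := by
  have hint := (integrable_indicator_iff (measurableSet_paraboloidCap R a)).2
    (integrableOn_paraboloidCap (a := a) hR hf)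
  rw [← integral_indicator (measurableSet_paraboloidCap R a), Measure.volume_eq_prod,
    integral_prod_symm _ hint, ← integral_indicator measurableSet_Icc]
  congr 1
  ext y
  by_cases hy : y ∈ Icc 0 a
  · rw [indicator_of_mem hy, ← integral_indicator measurableSet_closedBall]
    congr 1
    ext Y
    have hmem : (‖Y‖ ≤ √(2 * R * a) ∧ ‖Y‖ ^ 2 / (2 * R) ≤ y ∧ y ≤ a) ↔
        Y ∈ closedBall 0 √(2 * R * y) := by
      rw [mem_closedBall_zero_iff, div_le_iff₀' (by positivity),
        ← Real.le_sqrt (norm_nonneg Y) (by have := hy.1; positivity)]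
      refine ⟨fun h => h.2.1, fun h => ⟨h.trans (Real.sqrt_le_sqrt ?_), h, hy.2⟩⟩
      exact mul_le_mul_of_nonneg_left hy.2 (by positivity)
    by_cases h : Y ∈ closedBall 0 √(2 * R * y)
    · rw [indicator_of_mem h]
      exact indicator_of_mem (a := (Y, y)) (hmem.2 h) f
    · rw [indicator_of_notMem h]
      exact indicator_of_notMem (a := (Y, y)) (fun h' => h (hmem.1 h')) f
  · rw [indicator_of_notMem hy]
    refine integral_eq_zero_of_ae (Eventually.of_forall fun Y => indicator_of_notMem ?_ _)
    rintro ⟨-, h2, h3⟩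
    exact hy ⟨le_trans (by positivity) h2, h3⟩

theorem setIntegral_paraboloidCap_quadratic [Nonempty ι] {R a : ℝ} (hR : 0 < R) (ha : 0 ≤ a)
    (w : ι → ℝ) (b s : ℝ) :
    ∫ p in {p : EuclideanSpace ℝ ι × ℝ |
        ‖p.1‖ ≤ √(2 * R * a) ∧ ‖p.1‖ ^ 2 / (2 * R) ≤ p.2 ∧ p.2 ≤ a},
        ((∑ j, p.1 j ^ 2 * w j) + (p.2 ^ 2 * s - 2 * p.2 * b * s)) =
      volume.real (ball (0 : EuclideanSpace ℝ ι) 1) * (2 * R) ^ ((Fintype.card ι : ℝ) / 2) *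
        (((∑ j, w j) * (2 * R) / (Fintype.card ι + 2) - 2 * b * s) *
            (a ^ ((Fintype.card ι : ℝ) / 2 + 2) / ((Fintype.card ι : ℝ) / 2 + 2)) +
          s * (a ^ ((Fintype.card ι : ℝ) / 2 + 3) / ((Fintype.card ι : ℝ) / 2 + 3))) := by
  set k : ℝ := (Fintype.card ι : ℝ) / 2 with hk
  have hk0 : 0 < k := by simp [hk, Fintype.card_pos]
  rw [setIntegral_paraboloidCap hR (by fun_prop)]
  have hslice : ∀ y ∈ Icc 0 a,
      ∫ Y in closedBall (0 : EuclideanSpace ℝ ι) √(2 * R * y),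
        ((∑ j, Y j ^ 2 * w j) + (y ^ 2 * s - 2 * y * b * s)) =
      volume.real (ball (0 : EuclideanSpace ℝ ι) 1) * (2 * R) ^ k *
        (((∑ j, w j) * (2 * R) / (Fintype.card ι + 2) - 2 * b * s) * y ^ (k + 1) +
          s * y ^ (k + 2)) := by
    rintro y ⟨hy, -⟩
    have hpow : √(2 * R * y) ^ Fintype.card ι = (2 * R) ^ k * y ^ k := by
      rw [← Real.mul_rpow (by positivity) hy, Real.sqrt_eq_rpow, ← Real.rpow_natCast,
        ← Real.rpow_mul (by positivity), hk]
      ring_nf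
    have h1 : y ^ (k + 1) = y ^ k * y := by
      rw [Real.rpow_add_one' hy (by positivity)]
    have h2 : y ^ (k + 2) = y ^ k * y ^ 2 := by
      rw [← Real.rpow_natCast y 2, ← Real.rpow_add' hy (by positivity)]
      norm_num
    rw [setIntegral_closedBall_quadratic (Real.sqrt_nonneg _), pow_add, hpow,
      Real.sq_sqrt (by positivity), h1, h2]
    ring
  rw [setIntegral_congr_fun measurableSet_Icc hslice, integral_Icc_eq_integral_Ioc,
    ← intervalIntegral.integral_of_le ha, intervalIntegral.integral_const_mul,
    intervalIntegral.integral_add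
      ((intervalIntegral.intervalIntegrable_rpow' (by linarith)).const_mul _)
      ((intervalIntegral.intervalIntegrable_rpow' (by linarith)).const_mul _),
    intervalIntegral.integral_const_mul, intervalIntegral.integral_const_mul,
    integral_rpow (Or.inl (by linarith)), integral_rpow (Or.inl (by linarith)),
    Real.zero_rpow (by linarith), Real.zero_rpow (by linarith)]
  ring_nf

end Cap

/-- **Asymptotics of `ψ(a)` (Meyer–Reisner, Section 3, step 1).** For the paraboloid cap
`D_a = {(Y,y) : |Y| ≤ √(2Ra), |Y|²/(2R) ≤ y ≤ a}` and
`ψ(a) = ∫_{D_a} (Σ_j Y_j²/λ_j² + y²/λₙ² − 2yb/λₙ²)`, one has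
`ψ(a) = (4(n−1)v_{n−1}(2R)^{(n−1)/2}/((n+1)(n+3))) a^{(n+3)/2}
          (αₙR − ((n+1)/(n−1)) b/λₙ²) + O(a^{(n+5)/2})` as `a → 0⁺`. -/
theorem psi_asymptotics {n : ℕ} (hn : 2 ≤ n) (R b : ℝ) (hR : 0 < R)
    (lam : Fin (n - 1) → ℝ) (hlam : ∀ j, 0 < lam j) (lamn : ℝ) (hlamn : 0 < lamn) :
    ∃ C : ℝ, ∃ a₀ > (0 : ℝ), ∀ a : ℝ, 0 < a → a ≤ a₀ →
      |(∫ p in {p : EuclideanSpace ℝ (Fin (n - 1)) × ℝ |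
            ‖p.1‖ ≤ Real.sqrt (2 * R * a) ∧ ‖p.1‖ ^ 2 / (2 * R) ≤ p.2 ∧ p.2 ≤ a},
          ((∑ j, (p.1 j) ^ 2 / (lam j) ^ 2) + p.2 ^ 2 / lamn ^ 2 - 2 * p.2 * b / lamn ^ 2))
        - 4 * ((n : ℝ) - 1) *
            (volume (Metric.ball (0 : EuclideanSpace ℝ (Fin (n - 1))) 1)).toReal *
            (2 * R) ^ (((n : ℝ) - 1) / 2) / (((n : ℝ) + 1) * ((n : ℝ) + 3)) *
            a ^ (((n : ℝ) + 3) / 2) *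
            ((((n : ℝ) - 1)⁻¹ * ∑ j, ((lam j) ^ 2)⁻¹) * R
              - (((n : ℝ) + 1) / ((n : ℝ) - 1)) * b / lamn ^ 2)|
      ≤ C * a ^ (((n : ℝ) + 5) / 2) := by
  have hn1 : ((n - 1 : ℕ) : ℝ) = (n : ℝ) - 1 := by
    rw [Nat.cast_sub (by omega), Nat.cast_one]
  have hn2 : (2 : ℝ) ≤ n := by exact_mod_cast hn
  have : Nonempty (Fin (n - 1)) := ⟨⟨0, by omega⟩⟩
  set v : ℝ := volume.real (ball (0 : EuclideanSpace ℝ (Fin (n - 1))) 1) with hv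
  refine ⟨|v * (2 * R) ^ (((n : ℝ) - 1) / 2) * ((lamn ^ 2)⁻¹ / (((n : ℝ) + 5) / 2))|, 1,
    one_pos, fun a ha _ => ?_⟩
  have h := setIntegral_paraboloidCap_quadratic hR ha.le (fun j => (lam j ^ 2)⁻¹) b (lamn ^ 2)⁻¹
  simp only [Fintype.card_fin, hn1] at h
  have e1 : ((n : ℝ) - 1) / 2 + 2 = (n + 3) / 2 := by ring
  have e2 : ((n : ℝ) - 1) / 2 + 3 = (n + 5) / 2 := by ring
  rw [e1, e2, ← hv] at h
  simp only [div_eq_mul_inv _ (_ ^ 2), add_sub_assoc]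
  rw [h, ← abs_of_pos (Real.rpow_pos_of_pos ha (((n : ℝ) + 5) / 2)), ← abs_mul,
    abs_of_pos (Real.rpow_pos_of_pos ha (((n : ℝ) + 5) / 2)), ← measureReal_def, ← hv]
  refine le_of_eq (congrArg abs ?_)
  have h1 : (n : ℝ) - 1 ≠ 0 := by linarith
  have h2 : (n : ℝ) + 1 ≠ 0 := by linarith
  have h3 : (n : ℝ) + 3 ≠ 0 := by linarith
  have h4 : (n : ℝ) - 1 + 2 = n + 1 := by ring
  rw [h4]
  field_simp
  ring
end
end

section
/- Fix n ≥ 2, R > 0, b ∈ ℝ and positive reals λ₁, …, λₙ, and set αₙ = (1/(n−1)) Σ_{j=1}^{n−1} λ_j^{−2}. In ℝⁿ = ℝ^{n−1} × ℝ (coordinates (Y, y), Y = (Y₁,…,Y_{n−1})) let C_a = {(Y, y) : |Y| ≤ √(2Ra), −a + √(2a/R)·|Y| ≤ y ≤ |Y|²/(2R)} and φ(a) = ∫_{C_a} ( Σ_{j=1}^{n−1} Y_j²/λ_j² + y²/λₙ² − 2yb/λₙ² ) dY dy. Then as a → 0⁺: φ(a) = (4(n−1) v_{n−1} (2R)^{(n−1)/2}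 / ((n+1)(n+3))) · a^{(n+3)/2} · ( αₙ R/(n+2) − ((n−3)/(n(n−1))) b/λₙ² ) + O(a^{(n+5)/2}). -/
open MeasureTheory Metric Set Filter
open scoped Topology

noncomputable section

theorem setIntegral_closedBall_norm_pow {E : Type*} [NormedAddCommGroup E] [NormedSpace ℝ E]
    [FiniteDimensional ℝ E] [MeasurableSpace E] [BorelSpace E] [Nontrivial E]
    (μ : Measure E) [μ.IsAddHaarMeasure] {ρ : ℝ} (hρ : 0 ≤ ρ) (k : ℕ) :
    ∫ x in closedBall (0 : E) ρ, ‖x‖ ^ k ∂μ =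
      Module.finrank ℝ E * μ.real (ball 0 1) *
        (ρ ^ (Module.finrank ℝ E + k) / (Module.finrank ℝ E + k)) := by
  have hd : 0 < Module.finrank ℝ E := Module.finrank_pos
  have h := integral_fun_norm_addHaar μ ((Iic ρ).indicator fun r : ℝ => r ^ k)
  rw [← integral_indicator measurableSet_closedBall]
  have e : (fun x : E => (closedBall (0 : E) ρ).indicator (fun x => ‖x‖ ^ k) x) =
      fun x => (Iic ρ).indicator (fun r : ℝ => r ^ k) ‖x‖ := by
    ext x; simp [indicator]
  rw [e, h]
  have e2 : ∫ y in Ioi (0 : ℝ),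
      y ^ (Module.finrank ℝ E - 1) • (Iic ρ).indicator (fun r : ℝ => r ^ k) y =
      ∫ y in (0 : ℝ)..ρ, y ^ (Module.finrank ℝ E - 1 + k) := by
    rw [intervalIntegral.integral_of_le hρ, ← Ioi_inter_Iic,
      ← setIntegral_indicator measurableSet_Iic]
    congr 1 with y
    by_cases hy : y ≤ ρ <;> simp [indicator, hy, pow_add]
  rw [e2, integral_pow]
  obtain ⟨d, hd'⟩ : ∃ d, Module.finrank ℝ E = d + 1 := ⟨_, (Nat.succ_pred_eq_of_pos hd).symm⟩
  rw [hd']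
  simp
  ring_nf

theorem setIntegral_closedBall_sq_coord_mul_norm_pow {m : ℕ} (ρ : ℝ) (k : ℕ) (j : Fin m) :
    ∫ x in closedBall (0 : EuclideanSpace ℝ (Fin m)) ρ, x j ^ 2 * ‖x‖ ^ k =
      (m : ℝ)⁻¹ * ∫ x in closedBall (0 : EuclideanSpace ℝ (Fin m)) ρ, ‖x‖ ^ (k + 2) := by
  have hm : (m : ℝ) ≠ 0 := by
    have := j.pos
    positivity
  have hswap (i : Fin m) :
      ∫ x in closedBall (0 : EuclideanSpace ℝ (Fin m)) ρ, x i ^ 2 * ‖x‖ ^ k =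
        ∫ x in closedBall (0 : EuclideanSpace ℝ (Fin m)) ρ, x j ^ 2 * ‖x‖ ^ k := by
    let e := LinearIsometryEquiv.piLpCongrLeft 2 ℝ ℝ (Equiv.swap i j)
    have h := e.measurePreserving.setIntegral_preimage_emb
      e.toHomeomorph.measurableEmbedding
      (fun x : EuclideanSpace ℝ (Fin m) => x i ^ 2 * ‖x‖ ^ k) (closedBall 0 ρ)
    rw [← h]
    simp [e]
  have hint (i : Fin m) : IntegrableOn (fun x : EuclideanSpace ℝ (Fin m) => x i ^ 2 * ‖x‖ ^ k)
      (closedBall 0 ρ) :=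
    ContinuousOn.integrableOn_compact (isCompact_closedBall _ _) (by fun_prop)
  have hsum : ∫ x in closedBall (0 : EuclideanSpace ℝ (Fin m)) ρ, ‖x‖ ^ (k + 2) =
      ∑ i, ∫ x in closedBall (0 : EuclideanSpace ℝ (Fin m)) ρ, x i ^ 2 * ‖x‖ ^ k := by
    rw [← integral_finsetSum _ fun i _ => hint i]
    congr 1 with x
    rw [← Finset.sum_mul, pow_add, EuclideanSpace.real_norm_sq_eq, mul_comm]
  simp [hsum, hswap, hm]

theorem setIntegral_between_graphs {E : Type*} [NormedAddCommGroup E] [NormedSpace ℝ E]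
    [FiniteDimensional ℝ E] [MeasurableSpace E] [BorelSpace E] (μ : Measure E) [SFinite μ]
    [IsFiniteMeasureOnCompacts μ] {ρ : ℝ} {l u : E → ℝ} (hl : Continuous l) (hu : Continuous u)
    (hlu : ∀ x, l x ≤ u x) {f : E × ℝ → ℝ} (hf : Continuous f) :
    ∫ p in {p : E × ℝ | ‖p.1‖ ≤ ρ ∧ l p.1 ≤ p.2 ∧ p.2 ≤ u p.1}, f p ∂μ.prod volume =
      ∫ x in closedBall 0 ρ, (∫ y in l x..u x, f (x, y)) ∂μ := by
  set S := {p : E × ℝ | ‖p.1‖ ≤ ρ ∧ l p.1 ≤ p.2 ∧ p.2 ≤ u p.1} with hS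
  have : ProperSpace E := FiniteDimensional.proper ℝ E
  have hclosed : IsClosed S := by
    have h1 : IsClosed {p : E × ℝ | ‖p.1‖ ≤ ρ} := isClosed_le (by fun_prop) (by fun_prop)
    have h2 : IsClosed {p : E × ℝ | l p.1 ≤ p.2} := isClosed_le (by fun_prop) (by fun_prop)
    have h3 : IsClosed {p : E × ℝ | p.2 ≤ u p.1} := isClosed_le (by fun_prop) (by fun_prop)
    exact h1.inter (h2.inter h3)
  obtain ⟨A, hA⟩ := (isCompact_closedBall (0 : E) ρ).bddBelow_image hl.continuousOn
  obtain ⟨B, hB⟩ := (isCompact_closedBall (0 : E) ρ).bddAbove_image hu.continuousOn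
  have hcompact : IsCompact S := by
    refine ((isCompact_closedBall (0 : E) ρ).prod
      (isCompact_Icc (a := A) (b := B))).of_isClosed_subset hclosed fun p hp => ?_
    have hp1 : p.1 ∈ closedBall (0 : E) ρ := by simpa using hp.1
    exact ⟨hp1, (hA ⟨_, hp1, rfl⟩).trans hp.2.1, hp.2.2.trans (hB ⟨_, hp1, rfl⟩)⟩
  have hint : IntegrableOn f S (μ.prod volume) := hf.continuousOn.integrableOn_compact hcompact
  rw [← integral_indicator hclosed.measurableSet,
    integral_prod _ (hint.integrable_indicator hclosed.measurableSet),
    ← integral_indicator measurableSet_closedBall]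
  congr 1 with x
  by_cases hx : ‖x‖ ≤ ρ
  · rw [indicator_of_mem (by simpa using hx), intervalIntegral.integral_of_le (hlu x),
      ← integral_Icc_eq_integral_Ioc, ← integral_indicator measurableSet_Icc]
    congr 1 with y
    simp [indicator, hS, hx]
  · simp [indicator, hS, hx]

theorem integral_quadratic_sub_linear (l u Q c d : ℝ) :
    ∫ y in l..u, (Q + c * y ^ 2 - 2 * d * y) =
      Q * (u - l) + c * (u ^ 3 - l ^ 3) / 3 - d * (u ^ 2 - l ^ 2) := by
  have hint {f : ℝ → ℝ} (hf : Continuous f) : IntervalIntegrable f volume l u :=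
    hf.intervalIntegrable l u
  rw [intervalIntegral.integral_sub (hint (by fun_prop)) (hint (by fun_prop)),
    intervalIntegral.integral_add (hint (by fun_prop)) (hint (by fun_prop)),
    intervalIntegral.integral_const_mul (2 * d) (fun y => y), integral_id,
    intervalIntegral.integral_const_mul, integral_pow, intervalIntegral.integral_const]
  simp only [smul_eq_mul]
  ring

theorem integral_cone_paraboloid_region {m : ℕ} (hm : 0 < m) {R ρ : ℝ} (hR : 0 < R) (hρ : 0 ≤ ρ)
    (q : Fin m → ℝ) (c d : ℝ) :
    ∫ p in {p : EuclideanSpace ℝ (Fin m) × ℝ | ‖p.1‖ ≤ ρ ∧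
        (2 * ρ * ‖p.1‖ - ρ ^ 2) / (2 * R) ≤ p.2 ∧ p.2 ≤ ‖p.1‖ ^ 2 / (2 * R)},
      ((∑ j, q j * p.1 j ^ 2) + c * p.2 ^ 2 - 2 * d * p.2) =
    m * volume.real (ball (0 : EuclideanSpace ℝ (Fin m)) 1) *
      (((m : ℝ)⁻¹ * (∑ j, q j) / (R * (m + 2) * (m + 3) * (m + 4))
          - d * ((m : ℝ) - 2) / (R ^ 2 * m * (m + 1) * (m + 2) * (m + 4))) * ρ ^ (m + 4)
        + c / (24 * R ^ 3) * (1 / (m + 6) - 8 / (m + 3) + 12 / (m + 2) - 6 / (m + 1) + 1 / m)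
          * ρ ^ (m + 6)) := by
  have : Nonempty (Fin m) := ⟨⟨0, hm⟩⟩
  have hm' : (0 : ℝ) < m := by exact_mod_cast hm
  have hint {f : EuclideanSpace ℝ (Fin m) → ℝ} (hf : Continuous f) :
      IntegrableOn f (closedBall 0 ρ) :=
    hf.continuousOn.integrableOn_compact (isCompact_closedBall _ _)
  have hnorm (k : ℕ) := setIntegral_closedBall_norm_pow
    (volume : Measure (EuclideanSpace ℝ (Fin m))) hρ k
  simp only [finrank_euclideanSpace_fin] at hnorm
  rw [Measure.volume_eq_prod, setIntegral_between_graphs volume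
    (l := fun x => (2 * ρ * ‖x‖ - ρ ^ 2) / (2 * R)) (u := fun x => ‖x‖ ^ 2 / (2 * R))
    (by fun_prop) (by fun_prop)
    (fun x => by gcongr; nlinarith [sq_nonneg (‖x‖ - ρ)]) (by fun_prop)]
  simp only [integral_quadratic_sub_linear]
  have hexpand (x : EuclideanSpace ℝ (Fin m)) :
      (∑ j, q j * x j ^ 2) * (‖x‖ ^ 2 / (2 * R) - (2 * ρ * ‖x‖ - ρ ^ 2) / (2 * R))
        + c * ((‖x‖ ^ 2 / (2 * R)) ^ 3 - ((2 * ρ * ‖x‖ - ρ ^ 2) / (2 * R)) ^ 3) / 3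
        - d * ((‖x‖ ^ 2 / (2 * R)) ^ 2 - ((2 * ρ * ‖x‖ - ρ ^ 2) / (2 * R)) ^ 2) =
      (∑ j, (q j / (2 * R) * (x j ^ 2 * ‖x‖ ^ 2) + -(q j * ρ / R) * (x j ^ 2 * ‖x‖ ^ 1)
        + q j * ρ ^ 2 / (2 * R) * (x j ^ 2 * ‖x‖ ^ 0)))
      + (c / (24 * R ^ 3) * ‖x‖ ^ 6 + -(d / (4 * R ^ 2)) * ‖x‖ ^ 4
        + -(c * ρ ^ 3 / (3 * R ^ 3)) * ‖x‖ ^ 3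
        + (c * ρ ^ 4 / (2 * R ^ 3) + d * ρ ^ 2 / R ^ 2) * ‖x‖ ^ 2
        + -(c * ρ ^ 5 / (4 * R ^ 3) + d * ρ ^ 3 / R ^ 2) * ‖x‖ ^ 1
        + (c * ρ ^ 6 / (24 * R ^ 3) + d * ρ ^ 4 / (4 * R ^ 2)) * ‖x‖ ^ 0) := by
    have hsum : (∑ j, (q j / (2 * R) * (x j ^ 2 * ‖x‖ ^ 2) + -(q j * ρ / R) * (x j ^ 2 * ‖x‖ ^ 1)
        + q j * ρ ^ 2 / (2 * R) * (x j ^ 2 * ‖x‖ ^ 0))) =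
        (∑ j, q j * x j ^ 2) * (‖x‖ ^ 2 / (2 * R) - (2 * ρ * ‖x‖ - ρ ^ 2) / (2 * R)) := by
      rw [Finset.sum_mul]
      refine Finset.sum_congr rfl fun j _ => ?_
      field_simp
      ring
    rw [hsum]
    field_simp
    ring
  simp only [hexpand]
  rw [integral_add (hint (by fun_prop)) (hint (by fun_prop)),
    integral_finsetSum _ fun j _ => hint (by fun_prop)]
  have hquad (j : Fin m) : ∫ x in closedBall (0 : EuclideanSpace ℝ (Fin m)) ρ,
      (q j / (2 * R) * (x j ^ 2 * ‖x‖ ^ 2) + -(q j * ρ / R) * (x j ^ 2 * ‖x‖ ^ 1)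
        + q j * ρ ^ 2 / (2 * R) * (x j ^ 2 * ‖x‖ ^ 0)) =
      q j * (volume.real (ball (0 : EuclideanSpace ℝ (Fin m)) 1) * ρ ^ (m + 4)
        / (R * (m + 2) * (m + 3) * (m + 4))) := by
    rw [integral_add (hint (by fun_prop)) (hint (by fun_prop)),
      integral_add (hint (by fun_prop)) (hint (by fun_prop))]
    simp only [integral_const_mul, setIntegral_closedBall_sq_coord_mul_norm_pow, hnorm]
    push_cast
    field_simp
    ring
  simp only [hquad, ← Finset.sum_mul]
  rw [integral_add (hint (by fun_prop)) (hint (by fun_prop)),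
    integral_add (hint (by fun_prop)) (hint (by fun_prop)),
    integral_add (hint (by fun_prop)) (hint (by fun_prop)),
    integral_add (hint (by fun_prop)) (hint (by fun_prop)),
    integral_add (hint (by fun_prop)) (hint (by fun_prop))]
  simp only [integral_const_mul, hnorm]
  push_cast
  field_simp
  ring

/-- **Asymptotics of `φ(a)` (Meyer–Reisner, Section 3, step 2).** For the region
`C_a = {(Y,y) : |Y| ≤ √(2Ra), −a + √(2a/R)|Y| ≤ y ≤ |Y|²/(2R)}` and
`φ(a) = ∫_{C_a} (Σ_j Y_j²/λ_j² + y²/λₙ² − 2yb/λₙ²)`, one has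
`φ(a) = (4(n−1)v_{n−1}(2R)^{(n−1)/2}/((n+1)(n+3))) a^{(n+3)/2}
          (αₙR/(n+2) − ((n−3)/(n(n−1))) b/λₙ²) + O(a^{(n+5)/2})` as `a → 0⁺`. -/
theorem phi_asymptotics {n : ℕ} (hn : 2 ≤ n) (R b : ℝ) (hR : 0 < R)
    (lam : Fin (n - 1) → ℝ) (hlam : ∀ j, 0 < lam j) (lamn : ℝ) (hlamn : 0 < lamn) :
    ∃ C : ℝ, ∃ a₀ > (0 : ℝ), ∀ a : ℝ, 0 < a → a ≤ a₀ →
      |(∫ p in {p : EuclideanSpace ℝ (Fin (n - 1)) × ℝ |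
            ‖p.1‖ ≤ Real.sqrt (2 * R * a) ∧
            -a + Real.sqrt (2 * a / R) * ‖p.1‖ ≤ p.2 ∧ p.2 ≤ ‖p.1‖ ^ 2 / (2 * R)},
          ((∑ j, (p.1 j) ^ 2 / (lam j) ^ 2) + p.2 ^ 2 / lamn ^ 2 - 2 * p.2 * b / lamn ^ 2))
        - 4 * ((n : ℝ) - 1) *
            (volume (Metric.ball (0 : EuclideanSpace ℝ (Fin (n - 1))) 1)).toReal *
            (2 * R) ^ (((n : ℝ) - 1) / 2) / (((n : ℝ) + 1) * ((n : ℝ) + 3)) *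
            a ^ (((n : ℝ) + 3) / 2) *
            ((((n : ℝ) - 1)⁻¹ * ∑ j, ((lam j) ^ 2)⁻¹) * R / ((n : ℝ) + 2)
              - (((n : ℝ) - 3) / ((n : ℝ) * ((n : ℝ) - 1))) * b / lamn ^ 2)|
      ≤ C * a ^ (((n : ℝ) + 5) / 2) := by
  have hm : 0 < n - 1 := by omega
  have hn' : (n : ℝ) = (n - 1 : ℕ) + 1 := by rw [Nat.cast_sub (by omega)]; simp
  rw [hn']
  generalize n - 1 = m at lam hlam hm ⊢
  have hm' : (0 : ℝ) < m := by exact_mod_cast hm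
  set v := volume.real (ball (0 : EuclideanSpace ℝ (Fin m)) 1) with hv
  set K := m * v * (1 / lamn ^ 2 / (24 * R ^ 3) *
    (1 / (m + 6) - 8 / (m + 3) + 12 / (m + 2) - 6 / (m + 1) + 1 / m)) with hK
  refine ⟨|K| * (2 * R) ^ (((m : ℝ) + 6) / 2), 1, one_pos, fun a ha _ => ?_⟩
  set ρ := √(2 * R * a) with hρ
  have hρ0 : 0 ≤ ρ := Real.sqrt_nonneg _
  have hρ2 : ρ ^ 2 = 2 * R * a := Real.sq_sqrt (by positivity)
  have hpow (k : ℕ) : ρ ^ k = (2 * R) ^ ((k : ℝ) / 2) * a ^ ((k : ℝ) / 2) := by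
    rw [← Real.mul_rpow (by positivity) ha.le, hρ, Real.sqrt_eq_rpow, ← Real.rpow_mul_natCast
      (by positivity)]
    ring_nf
  have hslope : √(2 * a / R) = ρ / R := by
    rw [eq_div_iff hR.ne', hρ, ← Real.sqrt_sq hR.le, ← Real.sqrt_mul (by positivity),
      Real.sqrt_sq hR.le]
    congr 1
    field_simp
  have hlower (r : ℝ) : -a + ρ / R * r = (2 * ρ * r - ρ ^ 2) / (2 * R) := by
    rw [hρ2]
    field_simp
    ring
  have hintegrand (p : EuclideanSpace ℝ (Fin m) × ℝ) :
      (∑ j, (p.1 j) ^ 2 / (lam j) ^ 2) + p.2 ^ 2 / lamn ^ 2 - 2 * p.2 * b / lamn ^ 2 =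
      (∑ j, ((lam j) ^ 2)⁻¹ * p.1 j ^ 2) + 1 / lamn ^ 2 * p.2 ^ 2 - 2 * (b / lamn ^ 2) * p.2 := by
    simp only [div_eq_inv_mul]
    ring
  simp only [hslope, hlower, hintegrand]
  rw [integral_cone_paraboloid_region hm hR hρ0]
  have h4 := hpow (m + 4)
  have h6 := hpow (m + 6)
  have hsplit : (2 * R) ^ (((m : ℝ) + 4) / 2) = (2 * R) ^ ((m : ℝ) / 2) * (2 * R) ^ 2 := by
    rw [← Real.rpow_add_natCast (by positivity)]
    congr 1
    push_cast
    ring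
  push_cast at h4 h6
  rw [show (m : ℝ) + 1 + 3 = m + 4 by ring, show (m : ℝ) + 1 + 5 = m + 6 by ring,
    show (m : ℝ) + 1 - 1 = m by ring, ← measureReal_def, ← hv]
  rw [hsplit] at h4
  refine le_of_eq ?_
  calc _ = |K * ρ ^ (m + 6)| := by
        rw [h4, hK]
        congr 1
        field_simp
        ring
    _ = _ := by
        rw [abs_mul, abs_of_nonneg (pow_nonneg hρ0 _), h6, mul_assoc]
end
end
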